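/- arXiv:1802.07130 — 6 statements merged into one kernel-verified Lean document; each statement's English description precedes it below -/
import Mathlib

section
/- Let d ≥ 2, n ≥ 1, let ψ ∈ ℂ^d be a unit vector, a ∈ ℝ with a ≠ 0, and set A = a·|ψ⟩⟨ψ|, a Hermitian d×d matrix. Consider the n-qudit Hamiltonian H = Σ_{i=1}^n M^{(i)}_i + Σ_{j ≠ k} α_{jk} · A_j A_k acting on (ℂ^d)^{⊗n}, where each M^{(i)} is an arbitrary Hermitian d×d matrix acting on qudit i, and α_{jk} ∈ ℝ. Then there exist d×d unitary matrices U_1,…,U_n such that every off-diagonal matrix entry of (U_1 ⊗ ⋯ ⊗ U_n) H (U_1 ⊗ ⋯ ⊗ U_n)† in the standard product basis of (ℂ^d)^{⊗n} is a nonpositive real number; i.e. H is equivalent under conjugation by a local (tensor product) unitary to a stoquastic Hamiltonian. -/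
open Matrix Finset

/-- The 1-local operator `M_i` on `(ℂ^d)^{⊗n}`: `M` acting on qudit `i`
and the identity elsewhere, as a matrix in the standard product basis. -/
noncomputable def oneLocal {d n : ℕ} (M : Matrix (Fin d) (Fin d) ℂ) (i : Fin n) :
    Matrix (Fin n → Fin d) (Fin n → Fin d) ℂ :=
  Matrix.of fun x y =>
    M (x i) (y i) * ∏ k ∈ univ.erase i, (if x k = y k then (1 : ℂ) else 0)

/-- The 2-local operator `A_i B_j` on `(ℂ^d)^{⊗n}`: `A` acting on qudit `i`,
`B` on qudit `j`, and the identity elsewhere. -/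
noncomputable def twoLocalProd {d n : ℕ} (A B : Matrix (Fin d) (Fin d) ℂ) (i j : Fin n) :
    Matrix (Fin n → Fin d) (Fin n → Fin d) ℂ :=
  Matrix.of fun x y =>
    A (x i) (y i) * B (x j) (y j) *
      ∏ k ∈ (univ.erase i).erase j, (if x k = y k then (1 : ℂ) else 0)

open scoped ComplexOrder

/-- The tensor product of a family of matrices, in the standard product basis. -/
def tensorFamily {ι κ : Type*} [Fintype ι] (B : ι → Matrix κ κ ℂ) :
    Matrix (ι → κ) (ι → κ) ℂ :=
  Matrix.of fun x y => ∏ i, B i (x i) (y i)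

theorem tensorFamily_apply {ι κ : Type*} [Fintype ι] (B : ι → Matrix κ κ ℂ) (x y : ι → κ) :
    tensorFamily B x y = ∏ i, B i (x i) (y i) := rfl

theorem tensorFamily_mul {ι κ : Type*} [Fintype ι] [DecidableEq ι] [Fintype κ]
    (A B : ι → Matrix κ κ ℂ) :
    tensorFamily A * tensorFamily B = tensorFamily fun i => A i * B i := by
  ext x y
  simp only [Matrix.mul_apply, tensorFamily_apply, Fintype.prod_sum, Finset.prod_mul_distrib]

theorem tensorFamily_conjTranspose {ι κ : Type*} [Fintype ι] (A : ι → Matrix κ κ ℂ) :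
    (tensorFamily A)ᴴ = tensorFamily fun i => (A i)ᴴ := by
  ext x y
  simp [tensorFamily_apply, Matrix.conjTranspose_apply]

theorem oneLocal_eq_tensorFamily {d n : ℕ} (M : Matrix (Fin d) (Fin d) ℂ) (i : Fin n) :
    oneLocal M i = tensorFamily (Function.update 1 i M) := by
  ext x y
  rw [tensorFamily_apply, ← Finset.mul_prod_erase _ _ (Finset.mem_univ i), oneLocal,
    Matrix.of_apply, Function.update_self]
  congr 1
  refine Finset.prod_congr rfl fun k hk => ?_
  rw [Function.update_of_ne (Finset.ne_of_mem_erase hk), Pi.one_apply, Matrix.one_apply]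

theorem twoLocalProd_eq_tensorFamily {d n : ℕ} (A B : Matrix (Fin d) (Fin d) ℂ) {i j : Fin n}
    (hij : i ≠ j) :
    twoLocalProd A B i j = tensorFamily (Function.update (Function.update 1 i A) j B) := by
  ext x y
  rw [tensorFamily_apply, ← Finset.mul_prod_erase _ _ (Finset.mem_univ i),
    ← Finset.mul_prod_erase (univ.erase i) _ (Finset.mem_erase.2 ⟨hij.symm, Finset.mem_univ j⟩),
    twoLocalProd, Matrix.of_apply, Function.update_self, Function.update_of_ne hij,
    Function.update_self, mul_assoc]
  congr 2
  refine Finset.prod_congr rfl fun k hk => ?_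
  rw [Function.update_of_ne (Finset.ne_of_mem_erase hk),
    Function.update_of_ne (Finset.ne_of_mem_erase (Finset.mem_of_mem_erase hk)),
    Pi.one_apply, Matrix.one_apply]

theorem tensorFamily_offDiag_eq_zero {ι κ : Type*} [Fintype ι] {B : ι → Matrix κ κ ℂ}
    (hB : ∀ i, (B i).IsDiag) {x y : ι → κ} (hxy : x ≠ y) : tensorFamily B x y = 0 := by
  obtain ⟨k, hk⟩ := Function.ne_iff.1 hxy
  exact Finset.prod_eq_zero (Finset.mem_univ k) (hB k hk)

theorem tensorFamily_update_one_offDiag_nonpos {ι κ : Type*} [Fintype ι] [DecidableEq ι]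
    [DecidableEq κ] {B : Matrix κ κ ℂ} (hB : ∀ s t, s ≠ t → B s t ≤ 0) (i : ι)
    {x y : ι → κ} (hxy : x ≠ y) : tensorFamily (Function.update 1 i B) x y ≤ 0 := by
  rw [tensorFamily_apply, ← Finset.mul_prod_erase _ _ (Finset.mem_univ i), Function.update_self]
  by_cases h : ∃ k, k ≠ i ∧ x k ≠ y k
  · obtain ⟨k, hki, hk⟩ := h
    rw [Finset.prod_eq_zero (Finset.mem_erase.2 ⟨hki, Finset.mem_univ k⟩), mul_zero]
    rw [Function.update_of_ne hki, Pi.one_apply, Matrix.one_apply_ne hk]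
  · push Not at h
    have hi : x i ≠ y i := fun hi => hxy <| funext fun k => by
      by_cases hk : k = i
      · rw [hk, hi]
      · exact h k hk
    rw [Finset.prod_eq_one, mul_one]
    · exact hB _ _ hi
    · intro k hk
      have hki := Finset.ne_of_mem_erase hk
      rw [Function.update_of_ne hki, Pi.one_apply, h k hki, Matrix.one_apply_eq]

/-- A unit vector extends to an orthonormal basis in which the compression of a given symmetric
operator to the orthogonal complement of the vector is diagonal. -/
theorem exists_orthonormal_cons_compression_diagonal {E : Type*} [NormedAddCommGroup E]
    [InnerProductSpace ℂ E] {m : ℕ} (hE : Module.finrank ℂ E = m + 1)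
    {T : E →ₗ[ℂ] E} (hT : T.IsSymmetric) {v : E} (hv : ‖v‖ = 1) :
    ∃ w : Fin m → E, Orthonormal ℂ (Fin.cons v w : Fin (m + 1) → E) ∧
      ∀ i j, i ≠ j → inner ℂ (w i) (T (w j)) = 0 := by
  have : FiniteDimensional ℂ E := Module.finite_of_finrank_eq_succ hE
  have : Fact (Module.finrank ℂ E = m + 1) := ⟨hE⟩
  have hv0 : v ≠ 0 := fun h => by simp [h] at hv
  let W : Submodule ℂ E := (ℂ ∙ v)ᗮ
  have hW : Module.finrank ℂ W = m := Submodule.finrank_orthogonal_span_singleton hv0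
  let S : W →ₗ[ℂ] W := W.orthogonalProjectionOnto.toLinearMap ∘ₗ T ∘ₗ W.subtype
  have hS_inner (x y : W) : inner ℂ x (S y) = inner ℂ (x : E) (T y) :=
    Submodule.inner_orthogonalProjectionOnto_eq_of_mem_left x (T y)
  have hS : S.IsSymmetric := fun x y => by
    rw [hS_inner, ← inner_conj_symm, hS_inner, inner_conj_symm, hT]
  let b := hS.eigenvectorBasis hW
  refine ⟨fun i => b i, ?_, fun i j hij => ?_⟩
  · rw [orthonormal_iff_ite]
    have hb := orthonormal_iff_ite.1 b.orthonormal
    have hvb (i : Fin m) : inner ℂ v (b i : E) = 0 :=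
      Submodule.mem_orthogonal_singleton_iff_inner_right.1 (b i).2
    have hbv (i : Fin m) : inner ℂ (b i : E) v = 0 :=
      Submodule.mem_orthogonal_singleton_iff_inner_left.1 (b i).2
    intro i j
    refine Fin.cases ?_ (fun i => ?_) i <;> refine Fin.cases ?_ (fun j => ?_) j
    · simp [hv, inner_self_eq_norm_sq_to_K]
    · simpa [(Fin.succ_ne_zero j).symm] using hvb j
    · simpa using hbv i
    · simpa using hb i j
  · rw [← hS_inner, hS.apply_eigenvectorBasis, inner_smul_right,
      orthonormal_iff_ite.1 b.orthonormal, if_neg hij, mul_zero]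

theorem exists_norm_one_mul_eq_neg_norm (z : ℂ) :
    ∃ c : ℂ, c * star c = 1 ∧ c * z = -(‖z‖ : ℂ) := by
  by_cases hz : z = 0
  · exact ⟨1, by simp, by simp [hz]⟩
  · have h : (‖z‖ : ℂ) ≠ 0 := by simpa using hz
    have hz' := Complex.conj_mul' z
    refine ⟨-(star z / ‖z‖), ?_, ?_⟩
    · simp only [star_neg, star_div₀, Complex.star_def, Complex.conj_ofReal, Complex.conj_conj]
      field_simp
      linear_combination hz'
    · simp only [Complex.star_def]
      field_simp
      linear_combination -hz'

/-- A local basis change making `M` stoquastic and the projector onto `ψ` diagonal. -/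
theorem exists_unitary_conj_nonpos_and_isDiag {d : ℕ} {ψ : Fin d → ℂ} (hψ : star ψ ⬝ᵥ ψ = 1)
    {M : Matrix (Fin d) (Fin d) ℂ} (hM : M.IsHermitian) :
    ∃ U ∈ Matrix.unitaryGroup (Fin d) ℂ,
      (∀ s t, s ≠ t → (U * M * Uᴴ) s t ≤ 0) ∧
        (U * Matrix.vecMulVec ψ (star ψ) * Uᴴ).IsDiag := by
  cases d with
  | zero => exact ⟨1, one_mem _, fun s => s.elim0, fun s => s.elim0⟩
  | succ m =>
  let v : EuclideanSpace ℂ (Fin (m + 1)) := WithLp.toLp 2 ψ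
  have inner_eq (x y : EuclideanSpace ℂ (Fin (m + 1))) :
      inner ℂ x y = star (x : Fin (m + 1) → ℂ) ⬝ᵥ (y : Fin (m + 1) → ℂ) := by
    rw [EuclideanSpace.inner_eq_star_dotProduct, dotProduct_comm]
  have hv : ‖v‖ = 1 := by
    have h : inner ℂ v v = 1 := (inner_eq v v).trans hψ
    rw [inner_self_eq_norm_sq_to_K] at h
    change ((‖v‖ : ℝ) : ℂ) ^ 2 = 1 at h
    have h' : ‖v‖ ^ 2 = 1 := by exact_mod_cast h
    exact (pow_eq_one_iff_of_nonneg (norm_nonneg v) two_ne_zero).1 h'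
  obtain ⟨w, hw, hwM⟩ := exists_orthonormal_cons_compression_diagonal
    finrank_euclideanSpace_fin (Matrix.isSymmetric_toEuclideanLin_iff.2 hM) hv
  choose c hc hcz using fun i =>
    exists_norm_one_mul_eq_neg_norm (inner ℂ (w i) (Matrix.toEuclideanLin M v))
  let b : Fin (m + 1) → EuclideanSpace ℂ (Fin (m + 1)) := Fin.cons v w
  let e : Fin (m + 1) → ℂ := Fin.cons 1 c
  have he (i) : e i * star (e i) = 1 := by
    refine Fin.cases ?_ (fun i => ?_) i
    · simp [e]
    · simpa [e] using hc i
  let U : Matrix (Fin (m + 1)) (Fin (m + 1)) ℂ := Matrix.of fun i k => e i * star (b i k)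
  have hU (N : Matrix (Fin (m + 1)) (Fin (m + 1)) ℂ) (i j) :
      (U * N * Uᴴ) i j = e i * star (e j) * inner ℂ (b i) (Matrix.toEuclideanLin N (b j)) := by
    rw [inner_eq, Matrix.mul_assoc]
    simp only [Matrix.mul_apply, U, Matrix.of_apply, Matrix.conjTranspose_apply,
      dotProduct, Finset.mul_sum, Matrix.toEuclideanLin, Pi.star_apply]
    refine Finset.sum_congr rfl fun k _ => ?_
    simp [Matrix.mulVec, dotProduct, Finset.mul_sum]
    refine Finset.sum_congr rfl fun l _ => ?_
    ring
  have hUU : U * Uᴴ = 1 := by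
    ext i j
    have h := hU 1 i j
    rw [Matrix.mul_one] at h
    rw [h]
    have hb : inner ℂ (b i) (b j) = if i = j then (1 : ℂ) else 0 := orthonormal_iff_ite.1 hw i j
    by_cases hij : i = j
    · subst hij
      rw [if_pos rfl] at hb
      simp only [he, Matrix.toLpLin_one, LinearMap.id_coe, id_eq, hb, mul_one,
        Matrix.one_apply_eq]
    · simp [hij, hb]
  have hUM : (U * M * Uᴴ).IsHermitian := Matrix.isHermitian_mul_mul_conjTranspose U hM
  have hcol (i : Fin m) : (U * M * Uᴴ) i.succ 0 ≤ 0 := by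
    rw [hU]
    have : e i.succ * star (e 0) * inner ℂ (b i.succ) (Matrix.toEuclideanLin M (b 0)) =
        -(‖inner ℂ (w i) (Matrix.toEuclideanLin M v)‖ : ℂ) := by
      rw [← hcz i]
      simp [e, b]
    rw [this]
    simp
  refine ⟨U, Matrix.mem_unitaryGroup_iff.2 hUU, fun s t => ?_, fun s t => ?_⟩
  · refine Fin.cases ?_ (fun s => ?_) s <;> refine Fin.cases ?_ (fun t => ?_) t
    · exact fun h => (h rfl).elim
    · intro _
      rw [← hUM.apply, star_nonpos_iff]
      exact hcol t
    · exact fun _ => hcol s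
    · intro hst
      rw [hU]
      refine (mul_eq_zero_of_right _ (hwM s t fun h => hst (by rw [h]))).le
  · intro hst
    have hUψ (i : Fin m) : (U *ᵥ ψ) i.succ = 0 := by
      have h : inner ℂ (b i.succ) (b 0) = 0 := hw.2 (Fin.succ_ne_zero i)
      rw [inner_eq] at h
      have : (U *ᵥ ψ) i.succ = e i.succ * (star (b i.succ : Fin (m + 1) → ℂ) ⬝ᵥ ψ) := by
        simp [Matrix.mulVec, dotProduct, U, Finset.mul_sum, mul_assoc]
      rw [this]
      exact mul_eq_zero_of_right _ h
    rw [Matrix.mul_vecMulVec, Matrix.vecMulVec_mul, ← Matrix.star_mulVec, Matrix.vecMulVec_apply,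
      Pi.star_apply]
    revert hst
    refine Fin.cases ?_ (fun s => ?_) s
    · refine Fin.cases (fun h => (h rfl).elim) (fun t _ => ?_) t
      rw [hUψ, star_zero, mul_zero]
    · intro _
      rw [hUψ, zero_mul]

/-- Any Hamiltonian built from interactions `A_j A_k` with `A = a|ψ⟩⟨ψ|`, plus arbitrary
1-local Hermitian terms, is equivalent under conjugation by a local (tensor product)
unitary to a stoquastic Hamiltonian: all off-diagonal entries of the conjugated matrix
in the standard product basis are nonpositive reals. -/
theorem rank_one_projector_hamiltonian_stoquastic (d n : ℕ) (hd : 2 ≤ d) (hn : 1 ≤ n)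
    (ψ : Fin d → ℂ) (hψ : star ψ ⬝ᵥ ψ = 1) (a : ℝ) (ha : a ≠ 0)
    (M : Fin n → Matrix (Fin d) (Fin d) ℂ) (hM : ∀ i, (M i).IsHermitian)
    (α : Fin n → Fin n → ℝ) :
    ∃ U : Fin n → Matrix (Fin d) (Fin d) ℂ,
      (∀ i, U i ∈ Matrix.unitaryGroup (Fin d) ℂ) ∧
      ∀ x y : Fin n → Fin d, x ≠ y →
        ∃ r : ℝ, r ≤ 0 ∧
          ((Matrix.of fun x y : Fin n → Fin d => ∏ i, U i (x i) (y i)) *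
              ((∑ i, oneLocal (M i) i) +
                ∑ p ∈ univ.filter (fun p : Fin n × Fin n => p.1 ≠ p.2),
                  (α p.1 p.2 : ℂ) •
                    twoLocalProd ((a : ℂ) • Matrix.vecMulVec ψ (star ψ))
                      ((a : ℂ) • Matrix.vecMulVec ψ (star ψ)) p.1 p.2) *
              (Matrix.of fun x y : Fin n → Fin d => ∏ i, U i (x i) (y i))ᴴ) x y
            = (r : ℂ) := by
  choose U hU hUM hUψ using fun i => exists_unitary_conj_nonpos_and_isDiag hψ (hM i)
  have hUU (i) : U i * (U i)ᴴ = 1 := Matrix.mem_unitaryGroup_iff.1 (hU i)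
  refine ⟨U, hU, fun x y hxy => ?_⟩
  set V : Matrix (Fin n → Fin d) (Fin n → Fin d) ℂ :=
    Matrix.of fun x y : Fin n → Fin d => ∏ i, U i (x i) (y i)
  have hV (B : Fin n → Matrix (Fin d) (Fin d) ℂ) :
      V * tensorFamily B * Vᴴ = tensorFamily fun i => U i * B i * (U i)ᴴ := by
    change tensorFamily U * tensorFamily B * (tensorFamily U)ᴴ = _
    rw [tensorFamily_conjTranspose, tensorFamily_mul, tensorFamily_mul]
  have hone (i) : (V * oneLocal (M i) i * Vᴴ) x y ≤ 0 := by
    rw [oneLocal_eq_tensorFamily, hV]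
    have : (fun k => U k * Function.update (1 : Fin n → Matrix (Fin d) (Fin d) ℂ) i (M i) k *
        (U k)ᴴ) = Function.update (1 : Fin n → Matrix (Fin d) (Fin d) ℂ) i
        (U i * M i * (U i)ᴴ) := by
      funext k
      by_cases hk : k = i
      · subst hk
        simp
      · simp [hk, hUU]
    rw [this]
    exact tensorFamily_update_one_offDiag_nonpos (hUM i) i hxy
  set A : Matrix (Fin d) (Fin d) ℂ := (a : ℂ) • Matrix.vecMulVec ψ (star ψ)
  have hA (k) : (U k * A * (U k)ᴴ).IsDiag := by
    rw [Matrix.mul_smul, Matrix.smul_mul]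
    exact (hUψ k).smul _
  have htwo (i j : Fin n) (hij : i ≠ j) : (V * twoLocalProd A A i j * Vᴴ) x y = 0 := by
    rw [twoLocalProd_eq_tensorFamily A A hij, hV]
    refine tensorFamily_offDiag_eq_zero (fun k => ?_) hxy
    by_cases hkj : k = j
    · subst hkj
      simpa using hA k
    · by_cases hki : k = i
      · subst hki
        simpa [hkj] using hA k
      · simp [hkj, hki, hUU]
  rw [Matrix.mul_add, Matrix.add_mul, Matrix.mul_sum, Matrix.mul_sum, Matrix.sum_mul,
    Matrix.sum_mul, Matrix.add_apply, Matrix.sum_apply, Matrix.sum_apply,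
    Finset.sum_eq_zero (s := univ.filter fun p : Fin n × Fin n => p.1 ≠ p.2), add_zero]
  · obtain ⟨hre, him⟩ := Complex.le_def.1 (Finset.sum_nonpos fun i (_ : i ∈ univ) => hone i)
    exact ⟨_, hre, Complex.ext rfl him⟩
  · intro p hp
    rw [Matrix.mul_smul, Matrix.smul_mul, Matrix.smul_apply,
      htwo _ _ (Finset.mem_filter.1 hp).2, smul_zero]
end

section
/- Let P_sym = (1/2)(I + SWAP) be the projector onto the symmetric subspace of ℂ² ⊗ ℂ², and for distinct sites i,j of the four-qubit space (ℂ²)^{⊗4} let (P_sym)_{ij} denote P_sym acting on qubits i and j and identity elsewhere. If a vector ψ ∈ (ℂ²)^{⊗4} satisfies (P_sym)_{12} ψ = (P_sym)_{23} ψ = (P_sym)_{34} ψ = (P_sym)_{41} ψ = 0 (the four edges of a 4-cycle), then ψ = 0. Equivalently, the Hamiltonian (P_sym)_{12} + (P_sym)_{23} + (P_sym)_{34} + (P_sym)_{41} has strictly positive smallest eigenvalue. -/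
open Matrix Finset

/-- The projector onto the symmetric subspace of `ℂ² ⊗ ℂ²`,
`P_sym = (I + SWAP)/2`, as a matrix. -/
noncomputable def Psym : Matrix (Fin 2 × Fin 2) (Fin 2 × Fin 2) ℂ :=
  Matrix.of fun p q =>
    ((if p = q then (1 : ℂ) else 0) + (if p.1 = q.2 ∧ p.2 = q.1 then (1 : ℂ) else 0)) / 2

/-- A two-qudit operator `K` applied to factors `i, j` of `(ℂ^d)^{⊗n}`,
with the identity elsewhere. -/
noncomputable def twoLocal {d n : ℕ} (K : Matrix (Fin d × Fin d) (Fin d × Fin d) ℂ)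
    (i j : Fin n) : Matrix (Fin n → Fin d) (Fin n → Fin d) ℂ :=
  Matrix.of fun x y =>
    K (x i, x j) (y i, y j) *
      ∏ k ∈ (univ.erase i).erase j, (if x k = y k then (1 : ℂ) else 0)

theorem twoLocal_Psym_apply {n : ℕ} {i j : Fin n} (hij : i ≠ j) (x y : Fin n → Fin 2) :
    twoLocal Psym i j x y =
      ((if x = y then (1 : ℂ) else 0) + (if x ∘ Equiv.swap i j = y then (1 : ℂ) else 0)) / 2 := by
  have h1 : x = y ↔ (x i, x j) = (y i, y j) ∧ ∀ k ∈ (univ.erase i).erase j, x k = y k := by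
    simp only [funext_iff, Prod.mk.injEq, mem_erase, mem_univ, and_true]
    grind
  have h2 : x ∘ Equiv.swap i j = y ↔
      (x i = y j ∧ x j = y i) ∧ ∀ k ∈ (univ.erase i).erase j, x k = y k := by
    simp only [funext_iff, Function.comp_apply, Equiv.swap_apply_def, mem_erase, mem_univ, and_true]
    grind
  rw [if_congr h1 rfl rfl, if_congr h2 rfl rfl]
  simp only [twoLocal, Psym, of_apply, prod_boole]
  by_cases h : ∀ k ∈ (univ.erase i).erase j, x k = y k
  · simp only [if_pos h, mul_one, and_iff_left h]
  · simp only [h, mul_zero, and_false, if_false, add_zero, zero_div]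

theorem twoLocal_Psym_mulVec {n : ℕ} {i j : Fin n} (hij : i ≠ j) (ψ : (Fin n → Fin 2) → ℂ)
    (x : Fin n → Fin 2) :
    (twoLocal Psym i j).mulVec ψ x = (ψ x + ψ (x ∘ Equiv.swap i j)) / 2 := by
  simp only [mulVec, dotProduct, twoLocal_Psym_apply hij, div_mul_eq_mul_div, add_mul, ite_mul,
    one_mul, zero_mul, ← sum_div, sum_add_distrib, sum_ite_eq, mem_univ, if_true]

/-- The kernel of `P_sym` on factors `i, j` consists of vectors antisymmetric in `i, j`. -/
theorem apply_comp_swap_of_twoLocal_Psym {n : ℕ} {i j : Fin n} (hij : i ≠ j)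
    {ψ : (Fin n → Fin 2) → ℂ} (h : (twoLocal Psym i j).mulVec ψ = 0) (x : Fin n → Fin 2) :
    ψ (x ∘ Equiv.swap i j) = -ψ x := by
  have hx := congrFun h x
  rw [twoLocal_Psym_mulVec hij, Pi.zero_apply] at hx
  linear_combination 2 * hx

theorem apply_eq_zero_of_twoLocal_Psym {n : ℕ} {i j : Fin n} (hij : i ≠ j)
    {ψ : (Fin n → Fin 2) → ℂ} (h : (twoLocal Psym i j).mulVec ψ = 0) {x : Fin n → Fin 2}
    (hx : x i = x j) : ψ x = 0 := by
  have key := apply_comp_swap_of_twoLocal_Psym hij h x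
  have hswap : x ∘ Equiv.swap i j = x := by
    funext k
    simp only [Function.comp_apply, Equiv.swap_apply_def]
    grind
  rw [hswap] at key
  linear_combination key / 2

/-- Frustration of the symmetric-subspace projectors on a 4-cycle of qubits:
if `(P_sym)_{12} ψ = (P_sym)_{23} ψ = (P_sym)_{34} ψ = (P_sym)_{41} ψ = 0`
for a four-qubit vector `ψ`, then `ψ = 0`. -/
theorem psym_four_cycle_frustrated (ψ : (Fin 4 → Fin 2) → ℂ)
    (h12 : (twoLocal Psym 0 1).mulVec ψ = 0)
    (h23 : (twoLocal Psym 1 2).mulVec ψ = 0)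
    (h34 : (twoLocal Psym 2 3).mulVec ψ = 0)
    (h41 : (twoLocal Psym 3 0).mulVec ψ = 0) :
    ψ = 0 := by
  funext x
  have h01 : (0 : Fin 4) ≠ 1 := by decide
  have h12' : (1 : Fin 4) ≠ 2 := by decide
  have hpigeon : x 0 = x 1 ∨ x 1 = x 2 ∨ x 0 = x 2 := by omega
  rcases hpigeon with hx | hx | hx
  · exact apply_eq_zero_of_twoLocal_Psym h01 h12 hx
  · exact apply_eq_zero_of_twoLocal_Psym h12' h23 hx
  · rw [Pi.zero_apply, ← neg_eq_zero, ← apply_comp_swap_of_twoLocal_Psym h01 h12]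
    exact apply_eq_zero_of_twoLocal_Psym h12' h23 (by simpa [Equiv.swap_apply_def] using hx)
end

section
/- Let h^AKLT = 3h + h² be the AKLT interaction on ℂ³ ⊗ ℂ³, where h is the spin-1 Heisenberg interaction, and consider on (ℂ³)^{⊗3} the Hamiltonian H₀ = h^AKLT_{12} + h^AKLT_{13} + h^AKLT_{23} + 6I. Then H₀ is positive semidefinite, and its kernel is exactly the one-dimensional span of the completely antisymmetric state on three qutrits Ψ = |012⟩ + |120⟩ + |201⟩ − |021⟩ − |210⟩ − |102⟩; i.e. H₀ has a unique ground state, namely Ψ, with ground energy 0. -/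
open Matrix Kronecker Finset
open scoped ComplexOrder

/-- The spin-1 matrix `X₃ = (1/√2)·[[0,1,0],[1,0,1],[0,1,0]]`. -/
noncomputable def X3 : Matrix (Fin 3) (Fin 3) ℂ :=
  ((1 : ℂ) / (Real.sqrt 2 : ℂ)) • (!![0, 1, 0; 1, 0, 1; 0, 1, 0] : Matrix (Fin 3) (Fin 3) ℂ)

/-- The spin-1 matrix `Y₃ = (i/√2)·[[0,−1,0],[1,0,−1],[0,1,0]]`. -/
noncomputable def Y3 : Matrix (Fin 3) (Fin 3) ℂ :=
  (Complex.I / (Real.sqrt 2 : ℂ)) • (!![0, -1, 0; 1, 0, -1; 0, 1, 0] : Matrix (Fin 3) (Fin 3) ℂ)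

/-- The spin-1 matrix `Z₃ = diag(1,0,−1)`. -/
noncomputable def Z3 : Matrix (Fin 3) (Fin 3) ℂ :=
  (!![1, 0, 0; 0, 0, 0; 0, 0, -1] : Matrix (Fin 3) (Fin 3) ℂ)

/-- The spin-1 Heisenberg interaction `h = X₃⊗X₃ + Y₃⊗Y₃ + Z₃⊗Z₃` on `ℂ³ ⊗ ℂ³`. -/
noncomputable def heis3 : Matrix (Fin 3 × Fin 3) (Fin 3 × Fin 3) ℂ :=
  X3 ⊗ₖ X3 + Y3 ⊗ₖ Y3 + Z3 ⊗ₖ Z3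

/-- The AKLT interaction `h^AKLT = 3h + h²`. -/
noncomputable def hAKLT : Matrix (Fin 3 × Fin 3) (Fin 3 × Fin 3) ℂ :=
  3 • heis3 + heis3 ^ 2

/-- The completely antisymmetric state on three qutrits,
`Ψ = |012⟩ + |120⟩ + |201⟩ − |021⟩ − |210⟩ − |102⟩`. -/
noncomputable def PsiAnti : (Fin 3 → Fin 3) → ℂ := fun x =>
  (if x = ![0, 1, 2] then 1 else 0) + (if x = ![1, 2, 0] then 1 else 0) +
    (if x = ![2, 0, 1] then 1 else 0) - (if x = ![0, 2, 1] then 1 else 0) -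
    (if x = ![2, 1, 0] then 1 else 0) - (if x = ![1, 0, 2] then 1 else 0)

/-- The spin-1 Heisenberg interaction has integer entries. -/
def heisInt : Matrix (Fin 3 × Fin 3) (Fin 3 × Fin 3) ℤ :=
  Matrix.of fun p q =>
    (if p = q then (1 - (p.1 : ℤ)) * (1 - (p.2 : ℤ)) else 0) +
      (if (p.1 : ℕ) + 1 = q.1 ∧ (q.2 : ℕ) + 1 = p.2 then 1 else 0) +
      (if (q.1 : ℕ) + 1 = p.1 ∧ (p.2 : ℕ) + 1 = q.2 then 1 else 0)

theorem heis3_eq_map : heis3 = heisInt.map (Int.cast : ℤ → ℂ) := by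
  have hs : ((Real.sqrt 2 : ℝ) : ℂ) ^ 2 = 2 := by
    rw [← Complex.ofReal_pow, Real.sq_sqrt (by norm_num)]; norm_num
  have hX : (1 / ((Real.sqrt 2 : ℝ) : ℂ)) * (1 / ((Real.sqrt 2 : ℝ) : ℂ)) = 1 / 2 := by
    rw [div_mul_div_comm, ← sq (Complex.ofReal _), hs]; norm_num
  have hY : (Complex.I / ((Real.sqrt 2 : ℝ) : ℂ)) * (Complex.I / ((Real.sqrt 2 : ℝ) : ℂ)) =
      -(1 / 2) := by
    rw [div_mul_div_comm, ← sq, ← sq (Complex.ofReal _), hs, Complex.I_sq]; norm_num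
  rw [heis3, X3, Y3, Z3, smul_kronecker, kronecker_smul, smul_smul, hX, smul_kronecker,
    kronecker_smul, smul_smul, hY]
  ext ⟨a, b⟩ ⟨c, d⟩
  fin_cases a <;> fin_cases b <;> fin_cases c <;> fin_cases d <;>
    norm_num [heisInt, kroneckerMap_apply]

/-- `3h + h² + 2`, which is six times the projection onto total spin two. -/
def spinTwoInt : Matrix (Fin 3 × Fin 3) (Fin 3 × Fin 3) ℤ :=
  3 • heisInt + heisInt ^ 2 + diagonal fun _ => 2

theorem spinTwoInt_transpose_mul_self : spinTwoIntᵀ * spinTwoInt = 6 • spinTwoInt := by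
  decide +kernel

/-- `h^AKLT + 2`, which is six times the projection onto total spin two. -/
noncomputable def spinTwo : Matrix (Fin 3 × Fin 3) (Fin 3 × Fin 3) ℂ :=
  spinTwoInt.map (Int.cast : ℤ → ℂ)

theorem hAKLT_add_two : hAKLT + (2 : ℂ) • 1 = spinTwo := by
  have h : (heisInt ^ 2).map (Int.cast : ℤ → ℂ) = heisInt.map (Int.cast : ℤ → ℂ) ^ 2 :=
    Matrix.map_pow heisInt (Int.castRingHom ℂ) 2
  rw [hAKLT, heis3_eq_map, ← h, spinTwo, spinTwoInt]
  ext p q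
  by_cases hpq : p = q <;> simp [-nsmul_eq_mul, Matrix.smul_apply, hpq] <;> simp

theorem spinTwo_posSemidef : spinTwo.PosSemidef := by
  have h : spinTwo = (1 / 6 : ℂ) • (spinTwoᴴ * spinTwo) := by
    have h₁ : spinTwoᴴ = spinTwoIntᵀ.map (Int.cast : ℤ → ℂ) := by
      ext p q; simp [spinTwo]
    have h₂ : (spinTwoIntᵀ * spinTwoInt).map (Int.cast : ℤ → ℂ) =
        spinTwoIntᵀ.map (Int.cast : ℤ → ℂ) * spinTwoInt.map (Int.cast : ℤ → ℂ) :=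
      Matrix.map_mul (f := Int.castRingHom ℂ)
    rw [h₁, spinTwo, ← h₂, spinTwoInt_transpose_mul_self]
    ext p q
    simp [-nsmul_eq_mul, Matrix.smul_apply]
  rw [h]
  exact (posSemidef_conjTranspose_mul_self spinTwo).smul (by simp)

theorem spinTwo_mulVec_eq_zero_iff (u : Fin 3 × Fin 3 → ℂ) :
    spinTwo *ᵥ u = 0 ↔ u (0, 0) = 0 ∧ u (0, 1) + u (1, 0) = 0 ∧
      u (0, 2) + 2 * u (1, 1) + u (2, 0) = 0 ∧ u (1, 2) + u (2, 1) = 0 ∧ u (2, 2) = 0 := by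
  have hQ : spinTwoInt = Matrix.of fun p q =>
      (![![![![6, 0, 0], ![0, 0, 0], ![0, 0, 0]], ![![0, 3, 0], ![3, 0, 0], ![0, 0, 0]],
          ![![0, 0, 1], ![0, 2, 0], ![1, 0, 0]]],
        ![![![0, 3, 0], ![3, 0, 0], ![0, 0, 0]], ![![0, 0, 2], ![0, 4, 0], ![2, 0, 0]],
          ![![0, 0, 0], ![0, 0, 3], ![0, 3, 0]]],
        ![![![0, 0, 1], ![0, 2, 0], ![1, 0, 0]], ![![0, 0, 0], ![0, 0, 3], ![0, 3, 0]],
          ![![0, 0, 0], ![0, 0, 0], ![0, 0, 6]]]] : Fin 3 → Fin 3 → Fin 3 → Fin 3 → ℤ)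
        p.1 p.2 q.1 q.2 := by decide +kernel
  rw [funext_iff, Prod.forall]
  simp only [spinTwo, hQ, mulVec, dotProduct, Fintype.sum_prod_type, Fin.sum_univ_three,
    Fin.forall_fin_succ, map_apply, of_apply]
  simp
  grind

theorem twoLocal_zero_one (K : Matrix (Fin 3 × Fin 3) (Fin 3 × Fin 3) ℂ) :
    twoLocal K (0 : Fin 3) 1 = (K ⊗ₖ (1 : Matrix (Fin 3) (Fin 3) ℂ)).submatrix
      (fun x => ((x 0, x 1), x 2)) (fun x => ((x 0, x 1), x 2)) := by
  ext x y
  have : ((univ : Finset (Fin 3)).erase 0).erase 1 = {2} := by decide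
  simp [twoLocal, this, Matrix.one_apply]

theorem twoLocal_zero_two (K : Matrix (Fin 3 × Fin 3) (Fin 3 × Fin 3) ℂ) :
    twoLocal K (0 : Fin 3) 2 = (K ⊗ₖ (1 : Matrix (Fin 3) (Fin 3) ℂ)).submatrix
      (fun x => ((x 0, x 2), x 1)) (fun x => ((x 0, x 2), x 1)) := by
  ext x y
  have : ((univ : Finset (Fin 3)).erase 0).erase 2 = {1} := by decide
  simp [twoLocal, this, Matrix.one_apply]

theorem twoLocal_one_two (K : Matrix (Fin 3 × Fin 3) (Fin 3 × Fin 3) ℂ) :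
    twoLocal K (1 : Fin 3) 2 = (K ⊗ₖ (1 : Matrix (Fin 3) (Fin 3) ℂ)).submatrix
      (fun x => ((x 1, x 2), x 0)) (fun x => ((x 1, x 2), x 0)) := by
  ext x y
  have : ((univ : Finset (Fin 3)).erase 1).erase 2 = {0} := by decide
  simp [twoLocal, this, Matrix.one_apply]

/-- An operator acting on one tensor factor kills a vector iff it kills every slice of it. -/
theorem kronecker_one_submatrix_mulVec_eq_zero_iff {m n l : Type*} [Fintype m] [Fintype n]
    [Fintype l] [DecidableEq n] (K : Matrix m m ℂ) (f : l → m × n) (g : m → n → l)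
    (hgf : ∀ x, g (f x).1 (f x).2 = x) (hfg : ∀ p c, f (g p c) = (p, c)) (v : l → ℂ) :
    (K ⊗ₖ (1 : Matrix n n ℂ)).submatrix f f *ᵥ v = 0 ↔
      ∀ c, K *ᵥ (fun p => v (g p c)) = 0 := by
  let e : l ≃ m × n := ⟨f, fun p => g p.1 p.2, hgf, fun p => hfg p.1 p.2⟩
  have key (p : m) (c : n) : ((K ⊗ₖ (1 : Matrix n n ℂ)).submatrix e e *ᵥ v) (e.symm (p, c)) =
      (K *ᵥ (fun p => v (e.symm (p, c)))) p := by
    rw [submatrix_mulVec_equiv]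
    simp [mulVec, dotProduct, Fintype.sum_prod_type, Matrix.one_apply]
  change (K ⊗ₖ (1 : Matrix n n ℂ)).submatrix e e *ᵥ v = 0 ↔
    ∀ c, K *ᵥ (fun p => v (e.symm (p, c))) = 0
  constructor
  · intro h c
    ext p
    rw [← key, h, Pi.zero_apply, Pi.zero_apply]
  · intro h
    ext x
    obtain ⟨⟨p, c⟩, rfl⟩ := e.symm.surjective x
    rw [key, h c, Pi.zero_apply, Pi.zero_apply]

theorem twoLocal_zero_one_mulVec_eq_zero_iff (K : Matrix (Fin 3 × Fin 3) (Fin 3 × Fin 3) ℂ)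
    (v : (Fin 3 → Fin 3) → ℂ) :
    twoLocal K (0 : Fin 3) 1 *ᵥ v = 0 ↔ ∀ c, K *ᵥ (fun p => v ![p.1, p.2, c]) = 0 := by
  rw [twoLocal_zero_one]
  exact kronecker_one_submatrix_mulVec_eq_zero_iff K _ (fun p c => ![p.1, p.2, c])
    (fun x => by ext i; fin_cases i <;> rfl) (fun _ _ => rfl) v

theorem twoLocal_zero_two_mulVec_eq_zero_iff (K : Matrix (Fin 3 × Fin 3) (Fin 3 × Fin 3) ℂ)
    (v : (Fin 3 → Fin 3) → ℂ) :
    twoLocal K (0 : Fin 3) 2 *ᵥ v = 0 ↔ ∀ c, K *ᵥ (fun p => v ![p.1, c, p.2]) = 0 := by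
  rw [twoLocal_zero_two]
  exact kronecker_one_submatrix_mulVec_eq_zero_iff K _ (fun p c => ![p.1, c, p.2])
    (fun x => by ext i; fin_cases i <;> rfl) (fun _ _ => rfl) v

theorem twoLocal_one_two_mulVec_eq_zero_iff (K : Matrix (Fin 3 × Fin 3) (Fin 3 × Fin 3) ℂ)
    (v : (Fin 3 → Fin 3) → ℂ) :
    twoLocal K (1 : Fin 3) 2 *ᵥ v = 0 ↔ ∀ c, K *ᵥ (fun p => v ![c, p.1, p.2]) = 0 := by
  rw [twoLocal_one_two]
  exact kronecker_one_submatrix_mulVec_eq_zero_iff K _ (fun p c => ![c, p.1, p.2])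
    (fun x => by ext i; fin_cases i <;> rfl) (fun _ _ => rfl) v

theorem aklt_triangle_eq_sum_spinTwo :
    twoLocal hAKLT 0 1 + twoLocal hAKLT 0 2 + twoLocal hAKLT 1 2 +
        (6 : ℂ) • (1 : Matrix (Fin 3 → Fin 3) (Fin 3 → Fin 3) ℂ) =
      twoLocal spinTwo 0 1 + twoLocal spinTwo 0 2 + twoLocal spinTwo 1 2 := by
  have hone (x y : Fin 3 → Fin 3) : (1 : Matrix (Fin 3 → Fin 3) (Fin 3 → Fin 3) ℂ) x y =
      if x 0 = y 0 ∧ x 1 = y 1 ∧ x 2 = y 2 then 1 else 0 := by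
    simp [Matrix.one_apply, funext_iff, Fin.forall_fin_succ]
  simp only [← hAKLT_add_two, twoLocal_zero_one, twoLocal_zero_two, twoLocal_one_two]
  ext x y
  simp only [Matrix.add_apply, Matrix.smul_apply, hone, submatrix_apply, kroneckerMap_apply,
    Matrix.one_apply, Prod.mk.injEq, smul_eq_mul]
  by_cases h₀ : x 0 = y 0 <;> by_cases h₁ : x 1 = y 1 <;> by_cases h₂ : x 2 = y 2 <;>
    simp [h₀, h₁, h₂]
  ring

theorem posSemidef_add_mulVec_eq_zero_iff {n : Type*} [Fintype n] {A B : Matrix n n ℂ}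
    (hA : A.PosSemidef) (hB : B.PosSemidef) (v : n → ℂ) :
    (A + B) *ᵥ v = 0 ↔ A *ᵥ v = 0 ∧ B *ᵥ v = 0 := by
  rw [← (hA.add hB).dotProduct_mulVec_zero_iff, ← hA.dotProduct_mulVec_zero_iff,
    ← hB.dotProduct_mulVec_zero_iff, add_mulVec, dotProduct_add]
  exact add_eq_zero_iff_of_nonneg (hA.dotProduct_mulVec_nonneg v) (hB.dotProduct_mulVec_nonneg v)

/-- The three-qutrit AKLT Hamiltonian `H₀ = h^AKLT₁₂ + h^AKLT₁₃ + h^AKLT₂₃ + 6I` is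
positive semidefinite with kernel exactly the span of the completely antisymmetric
state on three qutrits: a unique ground state with ground energy `0`. -/
theorem aklt_triangle_unique_ground_state :
    (twoLocal hAKLT 0 1 + twoLocal hAKLT 0 2 + twoLocal hAKLT 1 2 +
        (6 : ℂ) • (1 : Matrix (Fin 3 → Fin 3) (Fin 3 → Fin 3) ℂ)).PosSemidef ∧
      LinearMap.ker
          (Matrix.toLin'
            (twoLocal hAKLT 0 1 + twoLocal hAKLT 0 2 + twoLocal hAKLT 1 2 +
              (6 : ℂ) • (1 : Matrix (Fin 3 → Fin 3) (Fin 3 → Fin 3) ℂ))) =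
        Submodule.span ℂ {PsiAnti} := by
  have h₀₁ : (twoLocal spinTwo (0 : Fin 3) 1).PosSemidef := by
    rw [twoLocal_zero_one]
    exact (spinTwo_posSemidef.kronecker PosSemidef.one).submatrix _
  have h₀₂ : (twoLocal spinTwo (0 : Fin 3) 2).PosSemidef := by
    rw [twoLocal_zero_two]
    exact (spinTwo_posSemidef.kronecker PosSemidef.one).submatrix _
  have h₁₂ : (twoLocal spinTwo (1 : Fin 3) 2).PosSemidef := by
    rw [twoLocal_one_two]
    exact (spinTwo_posSemidef.kronecker PosSemidef.one).submatrix _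
  rw [aklt_triangle_eq_sum_spinTwo]
  refine ⟨(h₀₁.add h₀₂).add h₁₂, ?_⟩
  ext v
  rw [LinearMap.mem_ker, toLin'_apply, posSemidef_add_mulVec_eq_zero_iff (h₀₁.add h₀₂) h₁₂,
    posSemidef_add_mulVec_eq_zero_iff h₀₁ h₀₂, twoLocal_zero_one_mulVec_eq_zero_iff,
    twoLocal_zero_two_mulVec_eq_zero_iff, twoLocal_one_two_mulVec_eq_zero_iff,
    Submodule.mem_span_singleton]
  simp only [spinTwo_mulVec_eq_zero_iff]
  constructor
  · rintro ⟨⟨h₁, h₂⟩, h₃⟩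
    refine ⟨v ![0, 1, 2], ?_⟩
    have ha := h₁ 0
    have hb := h₁ 1
    have hc := h₁ 2
    have hd := h₂ 0
    have he := h₂ 1
    have hf := h₂ 2
    have hg := h₃ 0
    have hh := h₃ 1
    have hi := h₃ 2
    clear h₁ h₂ h₃
    ext x
    obtain ⟨a, b, c, rfl⟩ : ∃ a b c, x = ![a, b, c] :=
      ⟨x 0, x 1, x 2, by ext i; fin_cases i <;> rfl⟩
    fin_cases a <;> fin_cases b <;> fin_cases c <;> simp [PsiAnti] <;> grind
  · rintro ⟨a, rfl⟩
    refine ⟨⟨fun c => ?_, fun c => ?_⟩, fun c => ?_⟩ <;> fin_cases c <;> simp [PsiAnti]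
end

section
/- Let d ≥ 2 and let S¹, S², S³ be complex d×d Hermitian matrices satisfying [S^a, S^b] = i·Σ_c ε_{abc} S^c and Σ_{a=1}^{3} (S^a)² = λ·I with λ = (d²−1)/4. Then for all a,b,c,e ∈ {1,2,3}: tr(S^a S^b S^c S^e) = (dλ/15)·( (λ−2)·δ_{ac}δ_{be} + (λ + 1/2)·(δ_{ab}δ_{ce} + δ_{ae}δ_{bc}) ). -/
open Matrix

/-- The completely antisymmetric Levi-Civita symbol on three (0-indexed) indices,
with `levi 0 1 2 = 1`, as a complex number. -/
noncomputable def levi (a b c : Fin 3) : ℂ :=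
  (((b : ℕ) : ℂ) - ((a : ℕ) : ℂ)) * (((c : ℕ) : ℂ) - ((b : ℕ) : ℂ)) *
    (((c : ℕ) : ℂ) - ((a : ℕ) : ℂ)) / 2

/-- The Kronecker delta `δ_{ab}` as a complex number. -/
noncomputable def kd (a b : Fin 3) : ℂ := if a = b then 1 else 0

/-- Elements `X, Y, Z` of a complex algebra satisfying the `su(2)` commutation relations,
with quadratic Casimir element equal to the scalar `l`. -/
structure SpinTriple {A : Type*} [Ring A] [Algebra ℂ A] (l : ℂ) (X Y Z : A) : Prop where
  comm_xy : X * Y - Y * X = Complex.I • Z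
  comm_yz : Y * Z - Z * Y = Complex.I • X
  comm_zx : Z * X - X * Z = Complex.I • Y
  casimir : X * X + Y * Y + Z * Z = l • (1 : A)

namespace SpinTriple

variable {A : Type*} [Ring A] [Algebra ℂ A] {l : ℂ} {X Y Z : A}

theorem rotate (h : SpinTriple l X Y Z) : SpinTriple l Y Z X :=
  ⟨h.comm_yz, h.comm_zx, h.comm_xy, by rw [← h.casimir]; abel⟩

/-- Quarter turn about the first axis. -/
theorem quarterTurn (h : SpinTriple l X Y Z) : SpinTriple l X (-Z) Y where
  comm_xy := by rw [← h.comm_zx]; noncomm_ring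
  comm_yz := by rw [← h.comm_yz]; noncomm_ring
  comm_zx := by rw [smul_neg, ← h.comm_xy]; noncomm_ring
  casimir := by rw [← h.casimir]; noncomm_ring

variable {τ : A →ₗ[ℂ] ℂ}

theorem map_mul_comm_xy (h : SpinTriple l X Y Z) (P Q : A) :
    τ (P * X * Y * Q) - τ (P * Y * X * Q) = Complex.I * τ (P * Z * Q) := by
  have e : P * X * Y * Q - P * Y * X * Q = P * (X * Y - Y * X) * Q := by noncomm_ring
  rw [← map_sub, e, h.comm_xy, mul_smul_comm, smul_mul_assoc, map_smul, smul_eq_mul]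

theorem map_mul_casimir (h : SpinTriple l X Y Z) (P : A) :
    τ (P * X * X) + τ (P * Y * Y) + τ (P * Z * Z) = l * τ P := by
  have e : P * X * X + P * Y * Y + P * Z * Z = P * (X * X + Y * Y + Z * Z) := by noncomm_ring
  rw [← map_add, ← map_add, e, h.casimir, mul_smul_comm, mul_one, map_smul, smul_eq_mul]

theorem map_x (h : SpinTriple l X Y Z) (hτ : ∀ P Q, τ (P * Q) = τ (Q * P)) : τ X = 0 := by
  have h1 := congrArg τ h.comm_yz
  rw [map_sub, hτ, sub_self, map_smul, smul_eq_mul] at h1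
  simpa using h1.symm

/-- If `P` commutes with `X`, then `P * Y` is a commutator. -/
theorem map_mul_y (h : SpinTriple l X Y Z) (hτ : ∀ P Q, τ (P * Q) = τ (Q * P)) {P : A}
    (hP : P * X = X * P) : τ (P * Y) = 0 := by
  have h1 := h.rotate.rotate.map_mul_comm_xy (τ := τ) P 1
  have h2 : τ (P * Z * X) = τ (P * X * Z) := by rw [hτ, ← mul_assoc, ← hP]
  simpa [h2] using h1.symm

theorem map_mul_z (h : SpinTriple l X Y Z) (hτ : ∀ P Q, τ (P * Q) = τ (Q * P)) {P : A}
    (hP : P * X = X * P) : τ (P * Z) = 0 := by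
  simpa using h.quarterTurn.map_mul_y hτ hP

theorem map_xx_eq_yy (h : SpinTriple l X Y Z) (hτ : ∀ P Q, τ (P * Q) = τ (Q * P)) :
    τ (X * X) = τ (Y * Y) := by
  have h1 := h.rotate.rotate.map_mul_comm_xy (τ := τ) 1 Y
  have h2 := h.rotate.map_mul_comm_xy (τ := τ) X 1
  simp only [one_mul, mul_one] at h1 h2
  have h3 : τ (Z * X * Y) = τ (X * Y * Z) := by rw [mul_assoc, hτ]
  have : Complex.I * (τ (X * X) - τ (Y * Y)) = 0 := by linear_combination h1 - h2 - h3
  simpa [sub_eq_zero] using this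

theorem map_xx (h : SpinTriple l X Y Z) (hτ : ∀ P Q, τ (P * Q) = τ (Q * P)) :
    τ (X * X) = l * τ 1 / 3 := by
  have h1 := h.map_mul_casimir (τ := τ) 1
  simp only [one_mul] at h1
  linear_combination (h1 + h.map_xx_eq_yy hτ - h.rotate.rotate.map_xx_eq_yy hτ) / 3

theorem map_xyy (h : SpinTriple l X Y Z) (hτ : ∀ P Q, τ (P * Q) = τ (Q * P)) :
    τ (X * Y * Y) = 0 := by
  rw [mul_assoc, hτ]
  exact h.rotate.map_mul_z hτ (by noncomm_ring)

theorem map_xzz (h : SpinTriple l X Y Z) (hτ : ∀ P Q, τ (P * Q) = τ (Q * P)) :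
    τ (X * Z * Z) = 0 := by
  rw [mul_assoc, hτ]
  exact h.rotate.rotate.map_mul_y hτ (by noncomm_ring)

theorem map_xxx (h : SpinTriple l X Y Z) (hτ : ∀ P Q, τ (P * Q) = τ (Q * P)) :
    τ (X * X * X) = 0 := by
  have h1 := h.map_mul_casimir (τ := τ) X
  rw [h.map_xyy hτ, h.map_xzz hτ, h.map_x hτ] at h1
  simpa using h1

theorem map_xzy (h : SpinTriple l X Y Z) (hτ : ∀ P Q, τ (P * Q) = τ (Q * P)) :
    τ (X * Z * Y) = -Complex.I * (l * τ 1 / 6) := by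
  have h1 := h.map_mul_comm_xy (τ := τ) X Y
  have h2 := h.map_mul_comm_xy (τ := τ) (X * Y) 1
  have h3 := h.rotate.map_mul_comm_xy (τ := τ) X 1
  simp only [mul_one] at h1 h2 h3
  have h4 : τ (X * Y * Y * X) = τ (X * X * Y * Y) := by
    rw [hτ]; simp only [mul_assoc]
  have h5 : Complex.I * (τ (X * Z * Y) + τ (X * Y * Z)) = 0 := by
    linear_combination -h1 - h2 - h4
  have h6 : τ (X * Z * Y) + τ (X * Y * Z) = 0 := by simpa using h5
  linear_combination (h6 - h3 - Complex.I * h.map_xx hτ) / 2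

theorem map_xxxy (h : SpinTriple l X Y Z) (hτ : ∀ P Q, τ (P * Q) = τ (Q * P)) :
    τ (X * X * X * Y) = 0 :=
  h.map_mul_y hτ (by noncomm_ring)

theorem map_xxxz (h : SpinTriple l X Y Z) (hτ : ∀ P Q, τ (P * Q) = τ (Q * P)) :
    τ (X * X * X * Z) = 0 :=
  h.map_mul_z hτ (by noncomm_ring)

theorem map_xxyz (h : SpinTriple l X Y Z) (hτ : ∀ P Q, τ (P * Q) = τ (Q * P)) :
    τ (X * X * Y * Z) = 0 := by
  have h1 := h.map_mul_comm_xy (τ := τ) (X * X) Y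
  have h2 := h.map_mul_comm_xy (τ := τ) (X * X * Y) 1
  have h3 := h.rotate.map_mul_comm_xy (τ := τ) (X * X) 1
  simp only [mul_one] at h1 h2 h3
  have h4 : τ (X * X * Y * Y * X) = τ (X * X * X * Y * Y) := by
    rw [hτ]; simp only [mul_assoc]
  have h5 : Complex.I * (τ (X * X * Z * Y) + τ (X * X * Y * Z)) = 0 := by
    linear_combination -h1 - h2 - h4
  have h6 : τ (X * X * Z * Y) + τ (X * X * Y * Z) = 0 := by simpa using h5
  rw [h.map_xxx hτ] at h3
  linear_combination (h6 + h3) / 2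

theorem map_xxzy (h : SpinTriple l X Y Z) (hτ : ∀ P Q, τ (P * Q) = τ (Q * P)) :
    τ (X * X * Z * Y) = 0 := by
  simpa using h.quarterTurn.map_xxyz hτ

theorem map_xyxz (h : SpinTriple l X Y Z) (hτ : ∀ P Q, τ (P * Q) = τ (Q * P)) :
    τ (X * Y * X * Z) = 0 := by
  have h1 := h.map_mul_comm_xy (τ := τ) X Z
  rw [h.map_xxyz hτ, h.map_xzz hτ] at h1
  simpa using h1

theorem map_xyxy (h : SpinTriple l X Y Z) (hτ : ∀ P Q, τ (P * Q) = τ (Q * P)) :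
    τ (X * Y * X * Y) = τ (X * X * Y * Y) - l * τ 1 / 6 := by
  have h1 := h.map_mul_comm_xy (τ := τ) X Y
  rw [h.map_xzy hτ] at h1
  linear_combination -h1 + l * τ 1 / 6 * Complex.I_mul_I

theorem map_xxxx_eq (h : SpinTriple l X Y Z) (hτ : ∀ P Q, τ (P * Q) = τ (Q * P)) :
    τ (X * X * X * X) = 3 * τ (X * X * Y * Y) - l * τ 1 / 6 := by
  have h1 := h.rotate.rotate.map_mul_comm_xy (τ := τ) 1 (X * X * Y)
  have h2 := h.rotate.rotate.map_mul_comm_xy (τ := τ) X (X * Y)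
  have h3 := h.rotate.rotate.map_mul_comm_xy (τ := τ) (X * X) Y
  have h4 := h.rotate.map_mul_comm_xy (τ := τ) (X * X * X) 1
  simp only [one_mul, mul_one, ← mul_assoc] at h1 h2 h3 h4
  have h5 : τ (Z * X * X * X * Y) = τ (X * X * X * Y * Z) := by
    rw [hτ (X * X * X * Y) Z]; simp only [mul_assoc]
  have h6 : τ (Y * X * X * Y) = τ (X * X * Y * Y) := by
    rw [hτ (X * X * Y) Y]; simp only [mul_assoc]
  have h7 : Complex.I * (τ (X * X * X * X) - (τ (Y * X * X * Y) + τ (X * Y * X * Y)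
      + τ (X * X * Y * Y))) = 0 := by
    linear_combination h1 + h2 + h3 - h4 - h5
  have h8 := (mul_eq_zero.mp h7).resolve_left Complex.I_ne_zero
  linear_combination h8 + h6 + h.map_xyxy hτ

theorem map_xxyy (h : SpinTriple l X Y Z) (hτ : ∀ P Q, τ (P * Q) = τ (Q * P)) :
    τ (X * X * Y * Y) = τ 1 * l / 15 * (l + 1 / 2) := by
  have h1 := h.map_xxxx_eq hτ
  have h2 := h.quarterTurn.map_xxxx_eq hτ
  have h3 := h.map_mul_casimir (τ := τ) (X * X)
  simp only [mul_neg, neg_mul, neg_neg] at h2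
  rw [h.map_xx hτ] at h3
  linear_combination (h3 - h1) / 5 + (h1 - h2) * (-1 / 15)

theorem map_xxxx (h : SpinTriple l X Y Z) (hτ : ∀ P Q, τ (P * Q) = τ (Q * P)) :
    τ (X * X * X * X) = τ 1 * l / 15 * (3 * l - 1) := by
  rw [h.map_xxxx_eq hτ, h.map_xxyy hτ]; ring

end SpinTriple

/-- Representatives `(0, i, j, m)`, with the leading zero omitted, of the words of length four
over `Fin 3` modulo simultaneous translation of the letters and cyclic rotation. -/
def necklaceReps : List (Fin 3 × Fin 3 × Fin 3) :=
  [(0, 0, 0), (0, 0, 1), (0, 0, 2), (0, 1, 1), (1, 0, 1), (0, 1, 2), (0, 2, 1), (1, 0, 2)]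

set_option synthInstance.maxSize 2000 in
theorem cyclic_mem_necklaceReps : ∀ a b c e : Fin 3,
    (b - a, c - a, e - a) ∈ necklaceReps ∨ (c - b, e - b, a - b) ∈ necklaceReps ∨
      (e - c, a - c, b - c) ∈ necklaceReps ∨ (a - e, b - e, c - e) ∈ necklaceReps := by
  decide

/-- Fourth-order trace identity for spin matrices: if `S¹,S²,S³` are Hermitian `d×d`
matrices with `[S^a,S^b] = i Σ_c ε_{abc} S^c` and `Σ_a (S^a)² = λI`, `λ = (d²−1)/4`,
then `tr(S^a S^b S^c S^e)
= (dλ/15)((λ−2)δ_{ac}δ_{be} + (λ+1/2)(δ_{ab}δ_{ce} + δ_{ae}δ_{bc}))`. -/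
theorem spin_trace_fourth_order (d : ℕ) (hd : 2 ≤ d)
    (S : Fin 3 → Matrix (Fin d) (Fin d) ℂ)
    (hHerm : ∀ a, (S a).IsHermitian)
    (hComm : ∀ a b, S a * S b - S b * S a = Complex.I • ∑ c, levi a b c • S c)
    (hCas : ∑ a, S a * S a = (((d : ℂ) ^ 2 - 1) / 4) • (1 : Matrix (Fin d) (Fin d) ℂ)) :
    ∀ a b c e : Fin 3,
      (S a * S b * S c * S e).trace =
        ((d : ℂ) * (((d : ℂ) ^ 2 - 1) / 4) / 15) *
          (((((d : ℂ) ^ 2 - 1) / 4) - 2) * kd a c * kd b e +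
            ((((d : ℂ) ^ 2 - 1) / 4) + 1 / 2) * (kd a b * kd c e + kd a e * kd b c)) := by
  set l : ℂ := ((d : ℂ) ^ 2 - 1) / 4
  have h : SpinTriple l (S 0) (S 1) (S 2) := by
    have h01 := hComm 0 1
    have h12 := hComm 1 2
    have h20 := hComm 2 0
    simp [Fin.sum_univ_three, levi] at h01 h12 h20
    norm_num at h01 h12 h20
    refine ⟨h01, h12, h20, ?_⟩
    rw [← hCas, Fin.sum_univ_three]
  have hs : ∀ k : Fin 3, SpinTriple l (S k) (S (k + 1)) (S (k + 2)) := by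
    intro k
    fin_cases k
    exacts [h, h.rotate, h.rotate.rotate]
  let τ := Matrix.traceLinearMap (Fin d) ℂ ℂ
  have hτ : ∀ P Q, τ (P * Q) = τ (Q * P) := Matrix.trace_mul_comm
  have h1 : τ 1 = d := by simp [τ]
  let G : Fin 3 → Fin 3 → Fin 3 → Fin 3 → Prop := fun a b c e =>
    τ (S a * S b * S c * S e) = (d : ℂ) * l / 15 * ((l - 2) * kd a c * kd b e +
      (l + 1 / 2) * (kd a b * kd c e + kd a e * kd b c))
  have kd_comm : ∀ a b, kd a b = kd b a := fun a b => by simp only [kd, eq_comm]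
  have cyc : ∀ a b c e, G b c e a → G a b c e := by
    intro a b c e hG
    simp only [G] at hG ⊢
    rw [mul_assoc, mul_assoc, hτ, ← mul_assoc, hG, kd_comm a b, kd_comm a c, kd_comm a e]
    ring
  have ne1 : ∀ k : Fin 3, k ≠ k + 1 := by decide
  have ne2 : ∀ k : Fin 3, k ≠ k + 2 := by decide
  have ne12 : ∀ k : Fin 3, k + 1 ≠ k + 2 := by decide
  have kd_self : ∀ k, kd k k = 1 := fun k => if_pos rfl
  have kd_ne : ∀ {a b}, a ≠ b → kd a b = 0 ∧ kd b a = 0 :=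
    fun hab => ⟨if_neg hab, if_neg hab.symm⟩
  have f1 : ∀ k, G k k k k := fun k => by
    simp only [G, (hs k).map_xxxx hτ, h1, kd_self]; ring
  have f2 : ∀ k, G k k k (k + 1) := fun k => by
    simp [G, (hs k).map_xxxy hτ, kd_ne (ne1 k)]
  have f3 : ∀ k, G k k k (k + 2) := fun k => by
    simp [G, (hs k).map_xxxz hτ, kd_ne (ne2 k)]
  have f4 : ∀ k, G k k (k + 1) (k + 1) := fun k => by
    simp [G, (hs k).map_xxyy hτ, h1, kd_self, kd_ne (ne1 k)]
  have f5 : ∀ k, G k (k + 1) k (k + 1) := fun k => by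
    simp only [G, (hs k).map_xyxy hτ, (hs k).map_xxyy hτ, h1, kd_self, kd_ne (ne1 k)]; ring
  have f6 : ∀ k, G k k (k + 1) (k + 2) := fun k => by
    simp [G, (hs k).map_xxyz hτ, kd_ne (ne1 k), kd_ne (ne2 k), kd_ne (ne12 k)]
  have f7 : ∀ k, G k k (k + 2) (k + 1) := fun k => by
    simp [G, (hs k).map_xxzy hτ, kd_ne (ne1 k), kd_ne (ne2 k), kd_ne (ne12 k)]
  have f8 : ∀ k, G k (k + 1) k (k + 2) := fun k => by
    simp [G, (hs k).map_xyxz hτ, kd_ne (ne1 k), kd_ne (ne2 k), kd_ne (ne12 k)]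
  have base : ∀ a b c e, (b - a, c - a, e - a) ∈ necklaceReps → G a b c e := by
    intro a b c e hL
    simp only [necklaceReps, List.mem_cons, List.not_mem_nil, or_false, Prod.mk.injEq, sub_eq_iff_eq_add',
      add_zero] at hL
    rcases hL with ⟨rfl, rfl, rfl⟩ | ⟨rfl, rfl, rfl⟩ | ⟨rfl, rfl, rfl⟩ | ⟨rfl, rfl, rfl⟩ |
      ⟨rfl, rfl, rfl⟩ | ⟨rfl, rfl, rfl⟩ | ⟨rfl, rfl, rfl⟩ | ⟨rfl, rfl, rfl⟩
    exacts [f1 _, f2 _, f3 _, f4 _, f5 _, f6 _, f7 _, f8 _]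
  intro a b c e
  rcases cyclic_mem_necklaceReps a b c e with hL | hL | hL | hL
  · exact base _ _ _ _ hL
  · exact cyc _ _ _ _ (base _ _ _ _ hL)
  · exact cyc _ _ _ _ (cyc _ _ _ _ (base _ _ _ _ hL))
  · exact cyc _ _ _ _ (cyc _ _ _ _ (cyc _ _ _ _ (base _ _ _ _ hL)))
end

section
/- Let h = X₃ ⊗ X₃ + Y₃ ⊗ Y₃ + Z₃ ⊗ Z₃ be the spin-1 Heisenberg interaction on ℂ³ ⊗ ℂ³, and work on the four-qutrit space (ℂ³)^{⊗4}, with h_{ij} denoting h applied to factors i,j and identity elsewhere. Let ψ₀ = (1/√3)(|02⟩ − |11⟩ + |20⟩) on factors 3,4, and let Π = I ⊗ I ⊗ |ψ₀⟩⟨ψ₀| be the orthogonal projector onto (ℂ³ ⊗ ℂ³) ⊗ ψ₀. Set A = h_{13} + h_{23} and B = h_{13}² + (1/2)h_{13} + h_{23}² + (1/2)h_{23} − (8/3)I. Then: ΠAΠ = 0, ΠBΠ = 0, Π A² Π = (4/3)(2I + h_{12})Π, and Π B² Π = ((2/3)h_{12}² + (1/3)h_{12} + (2/9)I)Π. -/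
open Matrix Kronecker Finset

/-- The normalized state `ψ₀ = (1/√3)(|02⟩ − |11⟩ + |20⟩)`. -/
noncomputable def psi0 : Fin 3 × Fin 3 → ℂ := fun p =>
  ((1 : ℂ) / (Real.sqrt 3 : ℂ)) *
    ((if p = (0, 2) then 1 else 0) - (if p = (1, 1) then 1 else 0) +
      (if p = (2, 0) then 1 else 0))

/-- The projector `Π = I ⊗ I ⊗ |ψ₀⟩⟨ψ₀|` onto `(ℂ³ ⊗ ℂ³) ⊗ ψ₀` on four qutrits. -/
noncomputable def Pi0 : Matrix (Fin 4 → Fin 3) (Fin 4 → Fin 3) ℂ :=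
  twoLocal (Matrix.vecMulVec psi0 (star psi0)) 2 3

/-- `h` on qutrits 1, 2. -/
noncomputable def h12 : Matrix (Fin 4 → Fin 3) (Fin 4 → Fin 3) ℂ := twoLocal heis3 0 1

/-- `h` on qutrits 1, 3. -/
noncomputable def h13 : Matrix (Fin 4 → Fin 3) (Fin 4 → Fin 3) ℂ := twoLocal heis3 0 2

/-- `h` on qutrits 2, 3. -/
noncomputable def h23 : Matrix (Fin 4 → Fin 3) (Fin 4 → Fin 3) ℂ := twoLocal heis3 1 2

/-- `A = h₁₃ + h₂₃`. -/
noncomputable def gadA : Matrix (Fin 4 → Fin 3) (Fin 4 → Fin 3) ℂ := h13 + h23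

/-- `B = h₁₃² + (1/2)h₁₃ + h₂₃² + (1/2)h₂₃ − (8/3)I`. -/
noncomputable def gadB : Matrix (Fin 4 → Fin 3) (Fin 4 → Fin 3) ℂ :=
  h13 ^ 2 + (1 / 2 : ℂ) • h13 + h23 ^ 2 + (1 / 2 : ℂ) • h23 -
    ((8 : ℂ) / 3) • (1 : Matrix (Fin 4 → Fin 3) (Fin 4 → Fin 3) ℂ)

section TwoLocal

variable {d n : ℕ}

theorem prod_erase_erase_ite_eq {i j : Fin n} (x y : Fin n → Fin d) :
    (∏ k ∈ (univ.erase i).erase j, (if x k = y k then (1 : ℂ) else 0)) =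
      if y = Function.update (Function.update x i (y i)) j (y j) then 1 else 0 := by
  have h : (∀ k ∈ (univ.erase i).erase j, x k = y k) ↔
      y = Function.update (Function.update x i (y i)) j (y j) := by
    constructor
    · intro h
      funext k
      by_cases hj : k = j
      · subst hj; simp
      by_cases hi : k = i
      · subst hi; simp [hj]
      · simp [hi, hj, h k (by simp [hi, hj])]
    · intro h k hk
      have hk' : k ≠ j ∧ k ≠ i := by simpa using hk
      rw [h]
      simp [hk'.1, hk'.2]
  simp only [prod_ite_zero, prod_const_one, h]

theorem twoLocal_mulVec (K : Matrix (Fin d × Fin d) (Fin d × Fin d) ℂ) {i j : Fin n}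
    (hij : i ≠ j) (v : (Fin n → Fin d) → ℂ) (x : Fin n → Fin d) :
    (twoLocal K i j *ᵥ v) x =
      ∑ p, K (x i, x j) p * v (Function.update (Function.update x i p.1) j p.2) := by
  simp only [mulVec, dotProduct, twoLocal, of_apply, prod_erase_erase_ite_eq]
  symm
  refine sum_of_injOn (fun p => Function.update (Function.update x i p.1) j p.2) ?_ ?_ ?_ ?_
  · intro p _ q _ h
    have h1 := congrFun h i
    have h2 := congrFun h j
    simp only [Function.update_self, Function.update_of_ne hij] at h1 h2
    exact Prod.ext h1 h2
  · simp
  · intro y _ hy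
    rw [if_neg, mul_zero, zero_mul]
    intro h
    exact hy ⟨(y i, y j), by simp, h.symm⟩
  · intro p _
    simp [Function.update_of_ne hij]

theorem twoLocal_mul (K L : Matrix (Fin d × Fin d) (Fin d × Fin d) ℂ) {i j : Fin n}
    (hij : i ≠ j) : twoLocal K i j * twoLocal L i j = twoLocal (K * L) i j := by
  refine ext_of_mulVec_single fun y => ?_
  rw [← mulVec_mulVec]
  funext x
  simp only [twoLocal_mulVec _ hij, Function.update_self, Function.update_of_ne hij, mul_apply,
    sum_mul, mul_sum]
  rw [sum_comm]
  refine sum_congr rfl fun p _ => sum_congr rfl fun q _ => ?_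
  rw [Function.update_comm hij, Function.update_idem, Function.update_comm hij.symm,
    Function.update_idem, mul_assoc]

theorem twoLocal_one {i j : Fin n} (hij : i ≠ j) :
    twoLocal (1 : Matrix (Fin d × Fin d) (Fin d × Fin d) ℂ) i j = 1 := by
  refine ext_of_mulVec_single fun y => ?_
  funext x
  simp only [twoLocal_mulVec _ hij, one_apply, ite_mul, one_mul, zero_mul, sum_ite_eq, mem_univ,
    if_true]
  simp [one_apply, Pi.single_apply]

theorem twoLocal_sub (K L : Matrix (Fin d × Fin d) (Fin d × Fin d) ℂ) (i j : Fin n) :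
    twoLocal (K - L) i j = twoLocal K i j - twoLocal L i j := by
  ext x y
  simp [twoLocal, sub_mul]

theorem twoLocal_smul (c : ℂ) (K : Matrix (Fin d × Fin d) (Fin d × Fin d) ℂ) (i j : Fin n) :
    twoLocal (c • K) i j = c • twoLocal K i j := by
  ext x y
  simp [twoLocal, mul_assoc]

theorem twoLocal_swap (K : Matrix (Fin d × Fin d) (Fin d × Fin d) ℂ) (i j : Fin n) :
    twoLocal (K.submatrix Prod.swap Prod.swap) i j = twoLocal K j i := by
  ext x y
  simp [twoLocal, erase_right_comm]

theorem commute_twoLocal (K L : Matrix (Fin d × Fin d) (Fin d × Fin d) ℂ) {i j k l : Fin n}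
    (hij : i ≠ j) (hkl : k ≠ l) (hik : i ≠ k) (hil : i ≠ l) (hjk : j ≠ k) (hjl : j ≠ l) :
    Commute (twoLocal K i j) (twoLocal L k l) := by
  refine ext_of_mulVec_single fun y => ?_
  simp only [← mulVec_mulVec]
  funext x
  simp only [twoLocal_mulVec _ hij, twoLocal_mulVec _ hkl, mul_sum,
    Function.update_of_ne hik, Function.update_of_ne hil, Function.update_of_ne hjk,
    Function.update_of_ne hjl, Function.update_of_ne hik.symm, Function.update_of_ne hil.symm,
    Function.update_of_ne hjk.symm, Function.update_of_ne hjl.symm]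
  rw [sum_comm]
  refine sum_congr rfl fun p _ => sum_congr rfl fun q _ => ?_
  rw [Function.update_comm hjk, Function.update_comm hik, Function.update_comm hjl,
    Function.update_comm hil]
  ring

/-- The swap operator on `ℂ^d ⊗ ℂ^d`. -/
def swapMatrix (d : ℕ) : Matrix (Fin d × Fin d) (Fin d × Fin d) ℂ :=
  (1 : Matrix (Fin d × Fin d) (Fin d × Fin d) ℂ).submatrix Prod.swap id

/-- The swap of the tensor factors `i` and `j`. -/
noncomputable def swapAt (i j : Fin n) : Matrix (Fin n → Fin d) (Fin n → Fin d) ℂ :=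
  twoLocal (swapMatrix d) i j

theorem swapMatrix_mul (K : Matrix (Fin d × Fin d) (Fin d × Fin d) ℂ) :
    swapMatrix d * K = K.submatrix Prod.swap id := by
  ext p q
  simp [swapMatrix, mul_apply, one_apply]

theorem swapAt_mulVec {i j : Fin n} (hij : i ≠ j) (v : (Fin n → Fin d) → ℂ)
    (x : Fin n → Fin d) : (swapAt i j *ᵥ v) x = v (x ∘ Equiv.swap i j) := by
  rw [swapAt, twoLocal_mulVec _ hij]
  simp only [swapMatrix, submatrix_apply, one_apply, Prod.swap_prod_mk, id, ite_mul, one_mul,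
    zero_mul, sum_ite_eq, mem_univ, if_true]
  congr 1
  funext k
  by_cases hj : k = j
  · subst hj; simp
  by_cases hi : k = i
  · subst hi; simp [hj]
  · simp [hi, hj, Equiv.swap_apply_of_ne_of_ne]

theorem swapAt_comm (i j : Fin n) :
    (swapAt i j : Matrix (Fin n → Fin d) (Fin n → Fin d) ℂ) = swapAt j i := by
  rw [swapAt, swapAt, ← twoLocal_swap]
  congr 1
  ext ⟨a, b⟩ ⟨c, e⟩
  simp [swapMatrix, one_apply, and_comm]

theorem swapAt_mul_self {i j : Fin n} (hij : i ≠ j) :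
    (swapAt i j : Matrix (Fin n → Fin d) (Fin n → Fin d) ℂ) * swapAt i j = 1 := by
  rw [swapAt, twoLocal_mul _ _ hij, swapMatrix_mul, ← twoLocal_one hij]
  congr 1

theorem swapAt_mul_twoLocal (K : Matrix (Fin d × Fin d) (Fin d × Fin d) ℂ) {i j k : Fin n}
    (hij : i ≠ j) (hik : i ≠ k) (hjk : j ≠ k) :
    swapAt i j * twoLocal K j k = twoLocal K i k * swapAt i j := by
  refine ext_of_mulVec_single fun y => ?_
  simp only [← mulVec_mulVec]
  funext x
  simp only [twoLocal_mulVec _ hik, swapAt_mulVec hij, twoLocal_mulVec _ hjk, Function.comp_apply,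
    Equiv.swap_apply_right, Equiv.swap_apply_of_ne_of_ne hik.symm hjk.symm,
    Function.update_comp_equiv, Equiv.symm_swap, Equiv.swap_apply_left]

end TwoLocal

section Brauer

variable {n : ℕ}

/-- The coefficients of the unnormalized singlet `|02⟩ − |11⟩ + |20⟩` of two spins 1. -/
def singlet : Fin 3 × Fin 3 → ℂ := fun p => !![0, 0, 1; 0, -1, 0; 1, 0, 0] p.1 p.2

/-- Three times the projector onto the singlet of the tensor factors `i` and `j`. -/
noncomputable def singletAt (i j : Fin n) : Matrix (Fin n → Fin 3) (Fin n → Fin 3) ℂ :=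
  twoLocal (vecMulVec singlet singlet) i j

theorem singlet_swap (p : Fin 3 × Fin 3) : singlet p.swap = singlet p := by
  obtain ⟨a, b⟩ := p
  fin_cases a <;> fin_cases b <;> simp [singlet]

theorem singletAt_comm (i j : Fin n) : singletAt i j = singletAt j i := by
  rw [singletAt, singletAt, ← twoLocal_swap]
  congr 1
  ext p q
  simp [vecMulVec_apply, singlet_swap]

theorem singletAt_mul_self {i j : Fin n} (hij : i ≠ j) :
    singletAt i j * singletAt i j = (3 : ℂ) • singletAt i j := by
  rw [singletAt, twoLocal_mul _ _ hij, ← twoLocal_smul, vecMulVec_mul_vecMulVec]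
  congr 1
  have h : singlet ⬝ᵥ singlet = 3 := by
    simp [dotProduct, Fintype.sum_prod_type, Fin.sum_univ_three, singlet]
    norm_num
  ext p q
  simp [h, vecMulVec_apply, mul_left_comm]

theorem swapAt_mul_singletAt {i j : Fin n} (hij : i ≠ j) :
    swapAt i j * singletAt i j = singletAt i j := by
  rw [swapAt, singletAt, twoLocal_mul _ _ hij, swapMatrix_mul]
  congr 1
  ext p q
  simp [vecMulVec_apply, singlet_swap]

theorem singletAt_mul_swapAt {i j : Fin n} (hij : i ≠ j) :
    singletAt i j * swapAt i j = singletAt i j := by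
  rw [swapAt, singletAt, twoLocal_mul _ _ hij]
  congr 1
  ext p q
  simp only [mul_apply, swapMatrix, submatrix_apply, one_apply, vecMulVec_apply, id]
  rw [sum_eq_single q.swap]
  · simp [singlet_swap]
  · intro r _ hr
    rw [if_neg, mul_zero]
    rintro rfl
    exact hr (Prod.swap_swap r).symm
  · simp

theorem singletAt_mulVec {i j : Fin n} (hij : i ≠ j) (v : (Fin n → Fin 3) → ℂ)
    (x : Fin n → Fin 3) :
    (singletAt i j *ᵥ v) x = singlet (x i, x j) *
      (v (Function.update (Function.update x i 0) j 2)
        - v (Function.update (Function.update x i 1) j 1)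
        + v (Function.update (Function.update x i 2) j 0)) := by
  rw [singletAt, twoLocal_mulVec _ hij]
  simp only [vecMulVec_apply, Fintype.sum_prod_type, Fin.sum_univ_three]
  simp [singlet]
  ring

theorem singletAt_mul_singletAt {i j k : Fin n} (hij : i ≠ j) (hik : i ≠ k) (hjk : j ≠ k) :
    singletAt i j * singletAt j k = singletAt i j * swapAt i k := by
  refine ext_of_mulVec_single fun y => ?_
  simp only [← mulVec_mulVec]
  funext x
  generalize (Pi.single y 1 : (Fin n → Fin 3) → ℂ) = v
  have key : ∀ a b : Fin 3,
      Function.update (Function.update x i a) j b ∘ Equiv.swap i k =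
        Function.update (Function.update (Function.update x i (x k)) j b) k a := by
    intro a b
    funext m
    by_cases hk : m = k
    · subst hk; simp [hij]
    by_cases hi : m = i
    · subst hi; simp [hij, hik, hik.symm, hjk.symm]
    by_cases hj : m = j
    · subst hj; simp [hjk, hij.symm, Equiv.swap_apply_of_ne_of_ne]
    · simp [hi, hj, hk, Equiv.swap_apply_of_ne_of_ne]
  simp only [singletAt_mulVec hij, swapAt_mulVec hik, singletAt_mulVec hjk, key,
    Function.update_self, Function.update_of_ne hik.symm, Function.update_of_ne hjk.symm,
    Function.update_idem]
  congr 1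
  generalize x k = c
  fin_cases c <;> simp [singlet] <;> ring

theorem singletAt_mul_swapAt_mul_singletAt {i j k : Fin n} (hij : i ≠ j) (hik : i ≠ k)
    (hjk : j ≠ k) : singletAt i j * swapAt i k * singletAt i j = singletAt i j := by
  have h : swapAt i k * singletAt i j = singletAt j k * swapAt i k := by
    rw [swapAt_comm, singletAt, swapAt_mul_twoLocal _ hik.symm hjk.symm hij, ← singletAt,
      singletAt_comm]
  rw [mul_assoc, h, ← mul_assoc, singletAt_mul_singletAt hij hik hjk, mul_assoc,
    swapAt_mul_self hik, mul_one]

theorem singletAt_mul_singletAt_mul_singletAt {i j k : Fin n} (hij : i ≠ j) (hik : i ≠ k)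
    (hjk : j ≠ k) : singletAt i j * singletAt j k * singletAt i j = singletAt i j := by
  rw [singletAt_mul_singletAt hij hik hjk, singletAt_mul_swapAt_mul_singletAt hij hik hjk]

theorem singletAt_compress_swapAt {i k l : Fin n} (hik : i ≠ k) (hil : i ≠ l)
    (hkl : k ≠ l) : singletAt k l * swapAt i k * singletAt k l = singletAt k l := by
  rw [swapAt_comm, singletAt_mul_swapAt_mul_singletAt hkl hik.symm hil.symm]

theorem singletAt_compress_singletAt {i k l : Fin n} (hik : i ≠ k) (hil : i ≠ l)
    (hkl : k ≠ l) : singletAt k l * singletAt i k * singletAt k l = singletAt k l := by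
  rw [singletAt_comm k l, singletAt_comm i k,
    singletAt_mul_singletAt_mul_singletAt hkl.symm hil.symm hik.symm]

theorem singletAt_compress_sq {i k l : Fin n} (c : ℂ) (hik : i ≠ k) (hil : i ≠ l)
    (hkl : k ≠ l) :
    singletAt k l * ((swapAt i k + c • singletAt i k) * (swapAt i k + c • singletAt i k)) *
      singletAt k l = (3 + 2 * c + 3 * c ^ 2) • singletAt k l := by
  have h : (swapAt i k + c • singletAt i k) * (swapAt i k + c • singletAt i k) =
      1 + (2 * c + 3 * c ^ 2) • singletAt i k := by
    simp only [add_mul, mul_add, smul_mul_assoc, mul_smul_comm, swapAt_mul_self hik,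
      swapAt_mul_singletAt hik, singletAt_mul_swapAt hik, singletAt_mul_self hik]
    module
  rw [h, mul_add, add_mul, mul_one, mul_smul_comm, smul_mul_assoc,
    singletAt_compress_singletAt hik hil hkl, singletAt_mul_self hkl]
  module

theorem singletAt_compress_mul {i j k l : Fin n} (c : ℂ) (hij : i ≠ j) (hik : i ≠ k)
    (hil : i ≠ l) (hjk : j ≠ k) (hjl : j ≠ l) (hkl : k ≠ l) :
    singletAt k l * ((swapAt i k + c • singletAt i k) * (swapAt j k + c • singletAt j k)) *
      singletAt k l =
      (((1 + c ^ 2) • swapAt i j + (2 * c) • singletAt i j) * singletAt k l) := by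
  have hS : Commute (swapAt i j) (singletAt k l) :=
    commute_twoLocal _ _ hij hkl hik hil hjk hjl
  have hT : Commute (singletAt i j) (singletAt k l) :=
    commute_twoLocal _ _ hij hkl hik hil hjk hjl
  have hSS : swapAt i k * swapAt j k = swapAt i j * swapAt (d := 3) i k := by
    rw [swapAt_comm j k]
    exact swapAt_mul_twoLocal _ hik hij hjk.symm
  have hST : swapAt i k * singletAt j k = singletAt i j * swapAt i k := by
    rw [singletAt_comm j k]
    exact swapAt_mul_twoLocal _ hik hij hjk.symm
  have hTS : singletAt i k * swapAt j k = swapAt j k * singletAt i j := by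
    rw [singletAt_comm i k, singletAt_comm i j, swapAt_comm j k]
    exact (swapAt_mul_twoLocal _ hjk.symm hik.symm hij.symm).symm
  have hTT : singletAt i k * singletAt j k = swapAt i j * singletAt j k := by
    rw [singletAt_comm j k, singletAt_mul_singletAt hik hij hjk.symm, singletAt_comm k j]
    exact (swapAt_mul_twoLocal _ hij hik hjk).symm
  have hl {X : Matrix (Fin n → Fin 3) (Fin n → Fin 3) ℂ} (hX : Commute X (singletAt k l))
      (Y : Matrix (Fin n → Fin 3) (Fin n → Fin 3) ℂ) :
      singletAt k l * (X * Y) * singletAt k l = X * (singletAt k l * Y * singletAt k l) := by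
    rw [← mul_assoc, ← hX.eq]
    simp only [mul_assoc]
  have hr {X : Matrix (Fin n → Fin 3) (Fin n → Fin 3) ℂ} (hX : Commute X (singletAt k l))
      (Y : Matrix (Fin n → Fin 3) (Fin n → Fin 3) ℂ) :
      singletAt k l * (Y * X) * singletAt k l = singletAt k l * Y * singletAt k l * X := by
    rw [mul_assoc, mul_assoc, hX.eq]
    simp only [mul_assoc]
  simp only [add_mul, mul_add, smul_mul_assoc, mul_smul_comm, hSS, hST, hTS, hTT, hl hS, hl hT,
    hr hT, singletAt_compress_swapAt hik hil hkl, singletAt_compress_swapAt hjk hjl hkl,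
    singletAt_compress_singletAt hjk hjl hkl, ← hT.eq]
  module

theorem singletAt_compress_add {i j k l : Fin n} (c : ℂ) (hik : i ≠ k)
    (hil : i ≠ l) (hjk : j ≠ k) (hjl : j ≠ l) (hkl : k ≠ l) :
    singletAt k l *
        ((swapAt i k + c • singletAt i k) + (swapAt j k + c • singletAt j k)) *
      singletAt k l = (2 + 2 * c) • singletAt k l := by
  simp only [mul_add, add_mul, mul_smul_comm, smul_mul_assoc,
    singletAt_compress_swapAt hik hil hkl, singletAt_compress_swapAt hjk hjl hkl,
    singletAt_compress_singletAt hik hil hkl, singletAt_compress_singletAt hjk hjl hkl]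
  module

theorem singletAt_compress_add_sq {i j k l : Fin n} (c : ℂ) (hij : i ≠ j)
    (hik : i ≠ k) (hil : i ≠ l) (hjk : j ≠ k) (hjl : j ≠ l) (hkl : k ≠ l) :
    singletAt k l *
        ((swapAt i k + c • singletAt i k) + (swapAt j k + c • singletAt j k)) ^ 2 *
      singletAt k l =
      ((6 + 4 * c + 6 * c ^ 2) • 1 + (2 + 2 * c ^ 2) • swapAt i j +
        (4 * c) • singletAt i j) * singletAt k l := by
  have expand (P X Y : Matrix (Fin n → Fin 3) (Fin n → Fin 3) ℂ) :
      P * (X + Y) ^ 2 * P =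
        P * (X * X) * P + P * (X * Y) * P + (P * (Y * X) * P + P * (Y * Y) * P) := by
    simp only [sq, mul_add, add_mul]
    abel
  rw [expand,
    singletAt_compress_sq c hik hil hkl, singletAt_compress_sq c hjk hjl hkl,
    singletAt_compress_mul c hij hik hil hjk hjl hkl,
    singletAt_compress_mul c hij.symm hjk hjl hik hil hkl, swapAt_comm j i, singletAt_comm j i]
  simp only [add_mul, smul_mul_assoc, one_mul]
  module

end Brauer

theorem heis3_eq_swap_sub_singlet : heis3 = swapMatrix 3 - vecMulVec singlet singlet := by
  have h2 : ((Real.sqrt 2 : ℂ))⁻¹ * ((Real.sqrt 2 : ℂ))⁻¹ = 1 / 2 := by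
    rw [← mul_inv, ← Complex.ofReal_mul, Real.mul_self_sqrt (by norm_num)]
    norm_num
  ext ⟨a, b⟩ ⟨c, e⟩
  fin_cases a <;> fin_cases b <;> fin_cases c <;> fin_cases e <;>
    simp [heis3, X3, Y3, Z3, swapMatrix, one_apply, vecMulVec_apply, singlet, div_eq_mul_inv,
      mul_mul_mul_comm, h2] <;> norm_num

theorem twoLocal_heis3 {n : ℕ} (i j : Fin n) :
    twoLocal heis3 i j = swapAt i j - singletAt i j := by
  rw [heis3_eq_swap_sub_singlet, twoLocal_sub, swapAt, singletAt]

theorem twoLocal_heis3_sq {n : ℕ} {i j : Fin n} (hij : i ≠ j) :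
    twoLocal heis3 i j ^ 2 = 1 + singletAt i j := by
  rw [twoLocal_heis3, sq, sub_mul, mul_sub, mul_sub, swapAt_mul_self hij,
    swapAt_mul_singletAt hij, singletAt_mul_swapAt hij, singletAt_mul_self hij]
  module

theorem Pi0_eq_singletAt : Pi0 = (1 / 3 : ℂ) • singletAt 2 3 := by
  have h3 : ((Real.sqrt 3 : ℂ))⁻¹ * ((Real.sqrt 3 : ℂ))⁻¹ = 1 / 3 := by
    rw [← mul_inv, ← Complex.ofReal_mul, Real.mul_self_sqrt (by norm_num)]
    norm_num
  have h : ∀ p, psi0 p = ((Real.sqrt 3 : ℂ))⁻¹ * singlet p := by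
    rintro ⟨a, b⟩
    fin_cases a <;> fin_cases b <;> simp [psi0, singlet]
  have hs : ∀ p, star (singlet p) = singlet p := by
    rintro ⟨a, b⟩
    fin_cases a <;> fin_cases b <;> simp [singlet]
  rw [Pi0, singletAt, ← twoLocal_smul]
  congr 1
  ext p q
  rw [vecMulVec_apply, Pi.star_apply, h, h, star_mul', hs, mul_mul_mul_comm]
  simp [vecMulVec_apply, h3]

/-- The second-order mediator gadget identities for the bilinear-biquadratic model:
`ΠAΠ = 0`, `ΠBΠ = 0`, `ΠA²Π = (4/3)(2I + h₁₂)Π` and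
`ΠB²Π = ((2/3)h₁₂² + (1/3)h₁₂ + (2/9)I)Π`. -/
theorem bilinear_biquadratic_gadget :
    Pi0 * gadA * Pi0 = 0 ∧
    Pi0 * gadB * Pi0 = 0 ∧
    Pi0 * gadA ^ 2 * Pi0 =
      ((4 : ℂ) / 3) •
        ((2 • (1 : Matrix (Fin 4 → Fin 3) (Fin 4 → Fin 3) ℂ) + h12) * Pi0) ∧
    Pi0 * gadB ^ 2 * Pi0 =
      (((2 : ℂ) / 3) • h12 ^ 2 + ((1 : ℂ) / 3) • h12 +
        ((2 : ℂ) / 9) • (1 : Matrix (Fin 4 → Fin 3) (Fin 4 → Fin 3) ℂ)) * Pi0 := by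
  have hP : singletAt (2 : Fin 4) 3 * singletAt 2 3 = (3 : ℂ) • singletAt 2 3 :=
    singletAt_mul_self (by decide)
  have hadd (c : ℂ) := singletAt_compress_add (i := 0) (j := 1) (k := 2) (l := (3 : Fin 4)) c
    (by decide) (by decide) (by decide) (by decide) (by decide)
  have hsq (c : ℂ) := singletAt_compress_add_sq (i := 0) (j := 1) (k := 2) (l := (3 : Fin 4)) c
    (by decide) (by decide) (by decide) (by decide) (by decide) (by decide)
  have hA : gadA = (swapAt 0 2 + (-1 : ℂ) • singletAt 0 2) +
      (swapAt 1 2 + (-1 : ℂ) • singletAt 1 2) := by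
    rw [gadA, h13, h23, twoLocal_heis3, twoLocal_heis3]
    module
  have hB : gadB = (1 / 2 : ℂ) • ((swapAt 0 2 + (1 : ℂ) • singletAt 0 2) +
      (swapAt 1 2 + (1 : ℂ) • singletAt 1 2)) - (2 / 3 : ℂ) • 1 := by
    rw [gadB, h13, h23, twoLocal_heis3_sq (by decide), twoLocal_heis3_sq (by decide),
      twoLocal_heis3, twoLocal_heis3]
    module
  rw [Pi0_eq_singletAt, h12, twoLocal_heis3_sq (by decide), twoLocal_heis3, hA, hB]
  refine ⟨?_, ?_, ?_, ?_⟩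
  · rw [smul_mul_assoc, smul_mul_assoc, mul_smul_comm, hadd]
    module
  · rw [smul_mul_assoc, smul_mul_assoc, mul_smul_comm, mul_sub, sub_mul, mul_smul_comm,
      smul_mul_assoc, hadd, mul_smul_comm (2 / 3 : ℂ), smul_mul_assoc]
    simp only [mul_one, hP]
    module
  · rw [smul_mul_assoc, smul_mul_assoc, mul_smul_comm, hsq]
    simp only [add_mul, sub_mul, smul_mul_assoc, mul_smul_comm, one_mul]
    module
  · specialize hadd 1
    specialize hsq 1
    generalize (swapAt (0 : Fin 4) 2 + (1 : ℂ) • singletAt 0 2) +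
      (swapAt 1 2 + (1 : ℂ) • singletAt 1 2) = C at hadd hsq ⊢
    rw [sq] at hsq
    simp only [sq, sub_mul, mul_sub, smul_mul_assoc, mul_smul_comm, mul_one, one_mul, hadd, hsq,
      hP]
    simp only [add_mul, sub_mul, smul_mul_assoc, one_mul]
    module
end

section
/- Let A and B be complex d×d Hermitian traceless matrices such that for every pair of orthonormal vectors ψ, φ ∈ ℂ^d (i.e. unit vectors with ⟨ψ, φ⟩ = 0) one has ⟨ψ, Aφ⟩·⟨φ, Bψ⟩ = ⟨ψ, Bφ⟩·⟨φ, Aψ⟩. Then A and B are linearly dependent over ℝ, i.e. there exist real numbers c, c', not both zero, with c·A = c'·B. -/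
open Matrix

namespace Matrix

variable {n : Type*} [Fintype n]

/-- The transition amplitudes of `A` and `B` between any two orthogonal vectors satisfy
`⟨ψ, Aφ⟩⟨φ, Bψ⟩ = ⟨ψ, Bφ⟩⟨φ, Aψ⟩`. -/
def TransitionSymm (A B : Matrix n n ℂ) : Prop :=
  ∀ ψ φ : n → ℂ, star ψ ⬝ᵥ φ = 0 →
    (star ψ ⬝ᵥ A *ᵥ φ) * (star φ ⬝ᵥ B *ᵥ ψ) = (star ψ ⬝ᵥ B *ᵥ φ) * (star φ ⬝ᵥ A *ᵥ ψ)

theorem exists_smul_star_dotProduct_self_eq_one {v : n → ℂ} (hv : v ≠ 0) :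
    ∃ r : ℝ, r ≠ 0 ∧ star ((r : ℂ) • v) ⬝ᵥ ((r : ℂ) • v) = 1 := by
  open ComplexOrder in
  have hpos : 0 < star v ⬝ᵥ v := dotProduct_star_self_pos_iff.2 hv
  obtain ⟨hre, him⟩ := Complex.pos_iff.1 hpos
  refine ⟨(√(star v ⬝ᵥ v).re)⁻¹, inv_ne_zero (Real.sqrt_pos.2 hre).ne', ?_⟩
  have hv' : star v ⬝ᵥ v = ((√(star v ⬝ᵥ v).re : ℝ) : ℂ) ^ 2 := by
    rw [← Complex.ofReal_pow, Real.sq_sqrt hre.le]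
    exact Complex.ext rfl him.symm
  have hne : ((√(star v ⬝ᵥ v).re : ℝ) : ℂ) ≠ 0 :=
    Complex.ofReal_ne_zero.2 (Real.sqrt_pos.2 hre).ne'
  simp only [star_smul, smul_dotProduct, dotProduct_smul, smul_eq_mul]
  generalize √(star v ⬝ᵥ v).re = s at *
  rw [hv']
  simp
  field_simp

theorem TransitionSymm.of_orthonormal {A B : Matrix n n ℂ}
    (h : ∀ ψ φ : n → ℂ, star ψ ⬝ᵥ ψ = 1 → star φ ⬝ᵥ φ = 1 → star ψ ⬝ᵥ φ = 0 →
      (star ψ ⬝ᵥ A *ᵥ φ) * (star φ ⬝ᵥ B *ᵥ ψ) = (star ψ ⬝ᵥ B *ᵥ φ) * (star φ ⬝ᵥ A *ᵥ ψ)) :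
    TransitionSymm A B := by
  intro ψ φ hψφ
  rcases eq_or_ne ψ 0 with rfl | hψ
  · simp
  rcases eq_or_ne φ 0 with rfl | hφ
  · simp
  obtain ⟨r, hr, hrψ⟩ := exists_smul_star_dotProduct_self_eq_one hψ
  obtain ⟨s, hs, hsφ⟩ := exists_smul_star_dotProduct_self_eq_one hφ
  have key := h _ _ hrψ hsφ (by simp [hψφ])
  simp only [star_smul, smul_dotProduct, dotProduct_smul, mulVec_smul, smul_eq_mul,
    RCLike.star_def, Complex.conj_ofReal] at key
  have hrs : ((r : ℂ) * s) ^ 2 ≠ 0 :=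
    pow_ne_zero 2 (mul_ne_zero (Complex.ofReal_ne_zero.2 hr) (Complex.ofReal_ne_zero.2 hs))
  refine mul_left_cancel₀ hrs ?_
  linear_combination key

variable [DecidableEq n]

theorem TransitionSymm.conj {A B : Matrix n n ℂ} (h : TransitionSymm A B)
    {U : Matrix n n ℂ} (hU : star U * U = 1) :
    TransitionSymm (star U * A * U) (star U * B * U) := by
  have transfer (M : Matrix n n ℂ) (ψ φ : n → ℂ) :
      star ψ ⬝ᵥ (star U * M * U) *ᵥ φ = star (U *ᵥ ψ) ⬝ᵥ M *ᵥ (U *ᵥ φ) := by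
    rw [star_mulVec, ← dotProduct_mulVec, mulVec_mulVec, mulVec_mulVec, star_eq_conjTranspose,
      Matrix.mul_assoc]
  intro ψ φ hψφ
  simp only [transfer]
  refine h _ _ ?_
  have := transfer 1 ψ φ
  rwa [Matrix.mul_one, hU, one_mulVec, one_mulVec, hψφ, eq_comm] at this

section Diagonal

variable {a : n → ℝ} {B : Matrix n n ℂ}

theorem TransitionSymm.apply_eq_zero_of_ne
    (h : TransitionSymm (diagonal fun i => (a i : ℂ)) B) {i j : n} (hij : a i ≠ a j) :
    B i j = 0 := by
  have hne : i ≠ j := fun e => hij (e ▸ rfl)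
  have hsub : (a i : ℂ) - a j ≠ 0 := sub_ne_zero.2 (Complex.ofReal_injective.ne hij)
  have h1 := h (Pi.single i 1 + Pi.single j 1) (Pi.single i 1 - Pi.single j 1)
    (by simp [hne, hne.symm, dotProduct_sub])
  have h2 := h (Pi.single i 1 + Pi.single j Complex.I) (Pi.single i 1 - Pi.single j Complex.I)
    (by simp [hne, hne.symm, dotProduct_sub])
  simp [hne, hne.symm, add_dotProduct, sub_dotProduct, dotProduct_sub, dotProduct_add, mulVec_add,
    mulVec_sub] at h1 h2
  refine mul_left_cancel₀ (mul_ne_zero hsub (by norm_num : (4 : ℂ) ≠ 0)) ?_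
  linear_combination (norm := skip) h1 - Complex.I * h2
  ring_nf
  simp [Complex.I_sq, Complex.I_pow_four]

theorem TransitionSymm.apply_eq_zero
    (h : TransitionSymm (diagonal fun i => (a i : ℂ)) B) (ha : ∃ p q, a p ≠ a q) {i j : n}
    (hij : i ≠ j) : B i j = 0 := by
  obtain ⟨k, hk⟩ : ∃ k, a i ≠ a k := by
    by_contra! hc
    obtain ⟨p, q, hpq⟩ := ha
    exact hpq ((hc p).symm.trans (hc q))
  by_cases hj : a i = a j
  · have hik : i ≠ k := fun e => hk (e ▸ rfl)
    have hjk : j ≠ k := fun e => hk (e ▸ hj)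
    have hsub : (a i : ℂ) - a k ≠ 0 := sub_ne_zero.2 (Complex.ofReal_injective.ne hk)
    have z1 := h.apply_eq_zero_of_ne hk
    have z2 := h.apply_eq_zero_of_ne hk.symm
    have z3 := h.apply_eq_zero_of_ne (hj ▸ hk : a j ≠ a k)
    have z4 := h.apply_eq_zero_of_ne (hj ▸ hk : a j ≠ a k).symm
    have key (x : ℂ) := h (Pi.single i 1 + Pi.single k 1)
      (Pi.single i 1 - Pi.single k 1 + Pi.single j x)
      (by simp [hij.symm, hik, hik.symm, hjk, dotProduct_sub, dotProduct_add])
    simp [hij, hij.symm, hik, hik.symm, hjk, hjk.symm, add_dotProduct, sub_dotProduct,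
      dotProduct_sub, dotProduct_add, mulVec_add, mulVec_sub, z1, z2, z3, z4] at key
    have h1 := key 1
    have h2 := key Complex.I
    refine mul_left_cancel₀ (mul_ne_zero hsub two_ne_zero) ?_
    simp at h1 h2
    linear_combination (norm := skip) -h1 + Complex.I * h2
    ring_nf
    simp [Complex.I_sq]
  · exact h.apply_eq_zero_of_ne hj

theorem TransitionSymm.collinear
    (h : TransitionSymm (diagonal fun i => (a i : ℂ)) B) {p q : n} (hpq : a p ≠ a q) (i : n) :
    ((a q : ℂ) - a p) * (B i i - B p p) = (B q q - B p p) * (a i - a p) := by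
  have hne : p ≠ q := fun e => hpq (e ▸ rfl)
  rcases eq_or_ne i p with rfl | hip
  · simp
  rcases eq_or_ne i q with rfl | hiq
  · ring
  have hoff {j k : n} (hjk : j ≠ k) : B j k = 0 := h.apply_eq_zero ⟨p, q, hpq⟩ hjk
  have key := h (Pi.single i 1 + Pi.single q 1 + Pi.single p 1)
    (Pi.single i 1 + Pi.single q Complex.I - Pi.single p (1 + Complex.I))
    (by simp [hne, hne.symm, hip, hip.symm, hiq, hiq.symm, dotProduct_sub, dotProduct_add])
  simp [hne, hne.symm, hip, hip.symm, hiq, hiq.symm, add_dotProduct, sub_dotProduct,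
    dotProduct_sub, dotProduct_add, mulVec_add, mulVec_sub, hoff] at key
  refine mul_left_cancel₀ (mul_ne_zero two_ne_zero Complex.I_ne_zero) ?_
  linear_combination key

theorem TransitionSymm.smul_eq_smul_diagonal
    (h : TransitionSymm (diagonal fun i => (a i : ℂ)) B) (ha : ∑ i, a i = 0) (hB : B.trace = 0)
    {p q : n} (hpq : a p ≠ a q) :
    ((a q : ℂ) - a p) • B = (B q q - B p p) • diagonal fun i => (a i : ℂ) := by
  have hcard : (Fintype.card n : ℂ) ≠ 0 := by
    have : Nonempty n := ⟨p⟩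
    exact_mod_cast Fintype.card_ne_zero
  have ha' : ∑ i, (a i : ℂ) = 0 := by exact_mod_cast ha
  have hsum := Finset.sum_congr rfl fun i (_ : i ∈ Finset.univ) => h.collinear hpq i
  replace hB : ∑ i, B i i = 0 := hB
  simp only [← Finset.mul_sum, Finset.sum_sub_distrib, ha', hB, Finset.sum_const,
    Finset.card_univ, nsmul_eq_mul] at hsum
  have hconst : ((a q : ℂ) - a p) * B p p = (B q q - B p p) * a p :=
    mul_left_cancel₀ hcard (by linear_combination -hsum)
  ext i j
  rcases eq_or_ne i j with rfl | hij
  · simp only [smul_apply, diagonal_apply_eq, smul_eq_mul]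
    linear_combination h.collinear hpq i + hconst
  · simp [hij, h.apply_eq_zero ⟨p, q, hpq⟩ hij]

end Diagonal

end Matrix

/-- If `A` and `B` are traceless Hermitian matrices such that
`⟨ψ, Aφ⟩⟨φ, Bψ⟩ = ⟨ψ, Bφ⟩⟨φ, Aψ⟩` for every pair of orthonormal vectors `ψ, φ`,
then `A` and `B` are linearly dependent over `ℝ`. -/
theorem symmetric_transition_implies_dependent (d : ℕ)
    (A B : Matrix (Fin d) (Fin d) ℂ)
    (hA : A.IsHermitian) (hB : B.IsHermitian)
    (hTrA : A.trace = 0) (hTrB : B.trace = 0)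
    (hsym : ∀ ψ φ : Fin d → ℂ,
      star ψ ⬝ᵥ ψ = 1 → star φ ⬝ᵥ φ = 1 → star ψ ⬝ᵥ φ = 0 →
        (star ψ ⬝ᵥ A.mulVec φ) * (star φ ⬝ᵥ B.mulVec ψ) =
          (star ψ ⬝ᵥ B.mulVec φ) * (star φ ⬝ᵥ A.mulVec ψ)) :
    ∃ c c' : ℝ, (c ≠ 0 ∨ c' ≠ 0) ∧ c • A = c' • B := by
  have hsymm : TransitionSymm A B := .of_orthonormal hsym
  let U : Matrix (Fin d) (Fin d) ℂ := hA.eigenvectorUnitary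
  have hU : star U * U = 1 := Unitary.coe_star_mul_self _
  have hU' : U * star U = 1 := Unitary.coe_mul_star_self _
  let a := hA.eigenvalues
  have hdiag : star U * A * U = diagonal fun i => (a i : ℂ) := by
    have := hA.conjStarAlgAut_star_eigenvectorUnitary
    rwa [Unitary.conjStarAlgAut_star_apply] at this
  have hback (M : Matrix (Fin d) (Fin d) ℂ) : U * (star U * M * U) * star U = M := by
    calc U * (star U * M * U) * star U = (U * star U) * M * (U * star U) := by
          simp only [Matrix.mul_assoc]
      _ = M := by rw [hU', Matrix.one_mul, Matrix.mul_one]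
  have htrace (M : Matrix (Fin d) (Fin d) ℂ) : (star U * M * U).trace = M.trace := by
    rw [trace_mul_comm, ← Matrix.mul_assoc, hU', Matrix.one_mul]
  have ha : ∑ i, a i = 0 := by
    have := htrace A
    rw [hdiag, hTrA, trace_diagonal] at this
    exact_mod_cast this
  by_cases hconst : ∃ p q, a p ≠ a q
  · obtain ⟨p, q, hpq⟩ := hconst
    have hre (i : Fin d) : (((star U * B * U) i i).re : ℂ) = (star U * B * U) i i :=
      (isHermitian_conjTranspose_mul_mul U hB).coe_re_apply_self i
    have h := hsymm.conj hU
    rw [hdiag] at h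
    have key := h.smul_eq_smul_diagonal ha ((htrace B).trans hTrB) hpq
    refine ⟨((star U * B * U) q q).re - ((star U * B * U) p p).re, a q - a p,
      .inr (sub_ne_zero.2 hpq.symm), ?_⟩
    rw [← hre p, ← hre q, ← hdiag] at key
    have := congrArg (fun M => U * M * star U) key
    simp only [Matrix.mul_smul, Matrix.smul_mul, hback] at this
    rw [← Complex.ofReal_sub, ← Complex.ofReal_sub, Complex.coe_smul, Complex.coe_smul] at this
    exact this.symm
  · push Not at hconst
    have hzero (i : Fin d) : a i = 0 := by
      have hd : (d : ℝ) ≠ 0 := by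
        exact_mod_cast (Fin.pos i).ne'
      simpa [hconst _ i, hd] using ha
    refine ⟨1, 0, .inl one_ne_zero, ?_⟩
    rw [← hback A, hdiag]
    simp [hzero]
end
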